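/- arXiv:1906.12206 — 6 statements merged into one kernel-verified Lean document; each statement's English description precedes it below -/
import Mathlib

section
/- Let l be a prime with l ≡ 4 (mod 5) and let j ∈ 𝔽_l satisfy j ≠ 0, j ≠ 1728 and J_l(j) = 0 (i.e., j is a supersingular j-invariant in 𝔽_l different from 0 and 1728). Then the polynomial f_j(x) = (x⁴ + 12x³ + 14x² − 12x + 1)³ − j·x⁵(1 − 11x − x²) has exactly 4 distinct roots in 𝔽_l. -/
open Polynomial

/-- The polynomial `J_l(t)` over `𝔽_l`, whose roots in `𝔽_l` are exactly the
supersingular `j`-invariants in characteristic `l` other than `0, 1728` lying in `𝔽_l`.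
Here `n_l = ⌊l/12⌋` and `s = 1` iff `l ≡ 3 (mod 4)`. -/
noncomputable def Jpoly (l : ℕ) : Polynomial (ZMod l) :=
  ∑ k ∈ Finset.range (l / 12 + 1),
    (Nat.choose (2 * (l / 12) + (if l % 4 = 3 then 1 else 0))
        (2 * k + (if l % 4 = 3 then 1 else 0)) : Polynomial (ZMod l)) *
    (Nat.choose (2 * (l / 12) - 2 * k) (l / 12 - k) : Polynomial (ZMod l)) *
    (-432) ^ (l / 12 - k) * (X - 1728) ^ k

/-- `a ^ 6 + b ^ 6` in terms of `s = a + b` and `p = a * b`. -/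
def sixthPowerSum {R : Type*} [CommRing R] (s p : R) : R :=
  s ^ 6 - 6 * s ^ 4 * p + 9 * s ^ 2 * p ^ 2 - 2 * p ^ 3

/-- The polynomial `(T - a ^ 6) * (T - b ^ 6)`, where `a + b = e * w - 2` and
`a * b = w ^ 2 + 4 + e - e * w`. -/
def sixthPowerQuadratic {R : Type*} [CommRing R] (w e T : R) : R :=
  T ^ 2 - sixthPowerSum (e * w - 2) (w ^ 2 + 4 + e - e * w) * T + (w ^ 2 + 4 + e - e * w) ^ 6

theorem sixthPowerSum_eq {R : Type*} [CommRing R] {e : R} (he : e ^ 2 + e = 1) (w : R) :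
    sixthPowerSum (e * w - 2) (w ^ 2 + 4 + e - e * w) =
      (- 12 * w ^ 5 - 70 * w ^ 3 + 30 * w ^ 2 - 90 * w + 142) +
      (w ^ 6 + 15 * w ^ 4 - 10 * w ^ 3 + 75 * w ^ 2 - 36 * w + 80) * e := by
  rw [sixthPowerSum]
  linear_combination
    (w ^ 6 * e ^ 4 - w ^ 6 * e ^ 3 - 4 * w ^ 6 * e ^ 2 + 3 * w ^ 6 * e + 2 * w ^ 6 - 6 * w ^ 5
    * e ^ 3 + 6 * w ^ 5 * e ^ 2 + 18 * w ^ 5 * e - 12 * w ^ 5 - 6 * w ^ 4 * e ^ 3 + 3 * w ^ 4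
    * e ^ 2 + 9 * w ^ 4 * e - 12 * w ^ 4 + 30 * w ^ 3 * e ^ 2 + 40 * w ^ 3 * e - 70 * w ^ 3 +
    9 * w ^ 2 * e ^ 2 - 15 * w ^ 2 * e - 66 * w ^ 2 - 30 * w * e - 90 * w - 2 * e + 14) * he

theorem sixth_power_product_eq {R : Type*} [CommRing R] {e : R} (he : e ^ 2 + e = 1) (w : R) :
    (w ^ 2 + 4 + e - e * w) ^ 6 =
      (w ^ 12 + 39 * w ^ 10 - 10 * w ^ 9 + 465 * w ^ 8 - 282 * w ^ 7 + 2555 * w ^ 6 - 2058 * w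
      ^ 5 + 7485 * w ^ 4 - 5690 * w ^ 3 + 11481 * w ^ 2 - 5430 * w + 7069) +
      (- 6 * w ^ 11 - 9 * w ^ 10 - 130 * w ^ 9 - 60 * w ^ 8 - 930 * w ^ 7 + 272 * w ^ 6 - 3072
      * w ^ 5 + 2655 * w ^ 4 - 5190 * w ^ 3 + 6030 * w ^ 2 - 3816 * w + 4256) * e := by
  have h2 : (w ^ 2 + 4 + e - e * w) ^ 2 = (w ^ 4 + 9 * w ^ 2 - 2 * w + 17) +
      (- 2 * w ^ 3 + w ^ 2 - 6 * w + 7) * e := by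
    linear_combination (w ^ 2 - 2 * w + 1) * he
  have h3 : (w ^ 2 + 4 + e - e * w) ^ 3 =
      ((w ^ 4 + 9 * w ^ 2 - 2 * w + 17) * (w ^ 2 + 4) +
        (- 2 * w ^ 3 + w ^ 2 - 6 * w + 7) * (1 - w)) +
      ((w ^ 4 + 9 * w ^ 2 - 2 * w + 17) * (1 - w) +
        (- 2 * w ^ 3 + w ^ 2 - 6 * w + 7) * (w ^ 2 + 4) -
        (- 2 * w ^ 3 + w ^ 2 - 6 * w + 7) * (1 - w)) * e := by
    rw [pow_succ, h2]
    linear_combination (- 2 * w ^ 3 + w ^ 2 - 6 * w + 7) * (1 - w) * he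
  rw [show 6 = 3 * 2 from rfl, pow_mul, h3]
  linear_combination ((w ^ 4 + 9 * w ^ 2 - 2 * w + 17) * (1 - w) +
        (- 2 * w ^ 3 + w ^ 2 - 6 * w + 7) * (w ^ 2 + 4) -
        (- 2 * w ^ 3 + w ^ 2 - 6 * w + 7) * (1 - w)) ^ 2 * he

theorem sixthPowerQuadratic_mul {R : Type*} [CommRing R] {e : R} (he : e ^ 2 + e = 1) (w T : R) :
    (T - 125) * (T - (w - 1) ^ 6) * (sixthPowerQuadratic w e T * sixthPowerQuadratic w (-1 - e) T) =
      (T ^ 2 + 10 * (w ^ 5 + 5 * w ^ 3 + 5 * w - 11) * T +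
          5 * (w ^ 5 + 5 * w ^ 3 + 5 * w - 11) ^ 2) ^ 3 -
        (3125 + 250 * (w ^ 5 + 5 * w ^ 3 + 5 * w - 11) +
          (w ^ 5 + 5 * w ^ 3 + 5 * w - 11) ^ 2) ^ 3 * T := by
  have he' : (-1 - e) ^ 2 + (-1 - e) = 1 := by linear_combination he
  have key : ∀ u v : R, (u + v * e) * (u + v * (-1 - e)) = u ^ 2 - u * v - v ^ 2 := by
    intro u v
    linear_combination (- v ^ 2) * he
  rw [sixthPowerQuadratic, sixthPowerQuadratic, sixthPowerSum_eq he, sixthPowerSum_eq he',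
    sixth_power_product_eq he, sixth_power_product_eq he']
  have := key (T ^ 2 - (- 12 * w ^ 5 - 70 * w ^ 3 + 30 * w ^ 2 - 90 * w + 142) * T +
      (w ^ 12 + 39 * w ^ 10 - 10 * w ^ 9 + 465 * w ^ 8 - 282 * w ^ 7 + 2555 * w ^ 6 - 2058 * w
      ^ 5 + 7485 * w ^ 4 - 5690 * w ^ 3 + 11481 * w ^ 2 - 5430 * w + 7069))
      (- 6 * w ^ 11 - 9 * w ^ 10 - 130 * w ^ 9 - 60 * w ^ 8 - 930 * w ^ 7 + 272 * w ^ 6 - 3072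
      * w ^ 5 + 2655 * w ^ 4 - 5190 * w ^ 3 + 6030 * w ^ 2 - 3816 * w + 4256 -
      (w ^ 6 + 15 * w ^ 4 - 10 * w ^ 3 + 75 * w ^ 2 - 36 * w + 80) * T)
  rw [show ∀ a b c d : R, T ^ 2 - (a + b * e) * T + (c + d * e) =
    (T ^ 2 - a * T + c) + (d - b * T) * e by intros; ring,
    show ∀ a b c d : R, T ^ 2 - (a + b * (-1 - e)) * T + (c + d * (-1 - e)) =
    (T ^ 2 - a * T + c) + (d - b * T) * (-1 - e) by intros; ring, this]
  ring

theorem exists_sq_add_self_eq_one {l : ℕ} [Fact l.Prime] (hl5 : l % 5 = 4) (hl2 : l ≠ 2) :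
    ∃ e : ZMod l, e ^ 2 + e = 1 := by
  have : Fact (Nat.Prime 5) := ⟨by norm_num⟩
  have h : IsSquare ((5 : ℕ) : ZMod l) := by
    rw [← ZMod.exists_sq_eq_prime_iff_of_mod_four_eq_one (p := 5) (by norm_num) hl2]
    refine ⟨2, ?_⟩
    rw [(ZMod.natCast_eq_natCast_iff' l 4 5).2 hl5]
    norm_num
  obtain ⟨a, ha⟩ := h
  have h2 : (2 : ZMod l) ≠ 0 := by
    intro h0
    have h0' : ((2 : ℕ) : ZMod l) = 0 := by exact_mod_cast h0
    rw [ZMod.natCast_eq_zero_iff] at h0'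
    exact hl2 ((Nat.prime_dvd_prime_iff_eq Fact.out Nat.prime_two).1 h0')
  refine ⟨(a - 1) / 2, ?_⟩
  push_cast at ha
  field_simp
  linear_combination -ha

theorem eq_one_of_pow_five_eq_one {l : ℕ} [Fact l.Prime] (hl5 : l % 5 = 4) {r : ZMod l}
    (hr : r ^ 5 = 1) : r = 1 := by
  have hr0 : r ≠ 0 := by
    rintro rfl
    simp at hr
  have h1 : orderOf r ∣ 5 := orderOf_dvd_of_pow_eq_one hr
  have h2 : orderOf r ∣ l - 1 := orderOf_dvd_of_pow_eq_one (ZMod.pow_card_sub_one_eq_one hr0)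
  rcases (Nat.dvd_prime (by norm_num)).1 h1 with h | h
  · exact orderOf_eq_one_iff.1 h
  · rw [h] at h2
    omega

theorem exists_pow_five_eq {l : ℕ} [Fact l.Prime] (hl5 : l % 5 = 4) {y : ZMod l} (hy : y ≠ 0) :
    ∃ r : ZMod l, r ^ 5 = y := by
  obtain ⟨q, hq⟩ : ∃ q, l - 1 = 5 * q + 3 := ⟨l / 5, by omega⟩
  refine ⟨y⁻¹ ^ (2 * q + 1), ?_⟩
  have h := ZMod.pow_card_sub_one_eq_one hy
  rw [hq] at h
  rw [← pow_mul, inv_pow, inv_eq_iff_eq_inv]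
  apply eq_inv_of_mul_eq_one_left
  rw [← pow_succ, show (2 * q + 1) * 5 + 1 = (5 * q + 3) * 2 by ring, pow_mul, h, one_pow]

theorem not_isSquare_sub_two {l : ℕ} [Fact l.Prime] (hl5 : l % 5 = 4) (hl2 : (2 : ZMod l) ≠ 0)
    (hl5' : (5 : ZMod l) ≠ 0) {e : ZMod l} (he : e ^ 2 + e = 1) : ¬ IsSquare (e - 2) := by
  rintro ⟨a, ha⟩
  obtain ⟨z, hz⟩ : ∃ z : ZMod l, 2 * z = -1 - e + a := ⟨(-1 - e + a) / 2, by field_simp⟩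
  have h : z ^ 2 - (-1 - e) * z + 1 = 0 := by
    have : (2 : ZMod l) * 2 * (z ^ 2 - (-1 - e) * z + 1) = 0 := by
      linear_combination (2 * z + (-1 - e + a) - 2 * (-1 - e)) * hz - ha - he
    simpa [hl2] using this
  have h5 : z ^ 5 = 1 := by
    have : z ^ 4 + z ^ 3 + z ^ 2 + z + 1 = 0 := by
      linear_combination (z ^ 2 - e * z + 1) * h + z ^ 2 * he
    linear_combination (z - 1) * this
  have h1 := eq_one_of_pow_five_eq_one hl5 h5
  rw [h1] at h
  apply hl5'
  linear_combination (2 - e) * h + he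

theorem eq_mul_pow_five_of_double_root {F : Type*} [Field F] (h5 : (5 : F) ≠ 0) {c K τ : F}
    (hK : K ≠ 0) (h : (τ ^ 2 + 10 * c * τ + 5 * c ^ 2) ^ 3 = K * τ)
    (h' : 3 * (τ ^ 2 + 10 * c * τ + 5 * c ^ 2) ^ 2 * (2 * τ + 10 * c) = K) :
    K = 1728 * c ^ 5 := by
  by_cases hq : τ ^ 2 + 10 * c * τ + 5 * c ^ 2 = 0
  · rw [hq] at h'
    exact absurd (by simpa using h'.symm) hK
  · have h1 : (τ ^ 2 + 10 * c * τ + 5 * c ^ 2) ^ 2 * 5 * (τ ^ 2 + 4 * c * τ - c ^ 2) = 0 := by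
      linear_combination τ * h' - h
    have h2 : τ ^ 2 + 4 * c * τ - c ^ 2 = 0 := by simpa [hq, h5] using h1
    have h3 : τ ^ 2 + 10 * c * τ + 5 * c ^ 2 = 6 * c * (τ + c) := by linear_combination h2
    rw [h3] at h'
    linear_combination - h' + 216 * c ^ 2 * (τ + 3 * c) * h2

theorem eq_mul_pow_five_of_sq_mul {F : Type*} [Field F] (h5 : (5 : F) ≠ 0) {c K τ : F} {R : F[X]}
    (hK : K ≠ 0) (h : (X ^ 2 + 10 * C c * X + 5 * C c ^ 2) ^ 3 - C K * X = (X - C τ) ^ 2 * R) :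
    K = 1728 * c ^ 5 := by
  apply eq_mul_pow_five_of_double_root h5 hK (τ := τ)
  · have := congrArg (eval τ) h
    simp at this
    linear_combination this
  · have := congrArg (fun p => eval τ (derivative p)) h
    simp [derivative_mul, derivative_pow] at this
    linear_combination this

theorem quintic_eq_sextic {F : Type*} [Field F] (j : F) {x t : F} (h : x ^ 2 + (t + 11) * x = 1) :
    (x ^ 4 + 12 * x ^ 3 + 14 * x ^ 2 - 12 * x + 1) ^ 3 - j * (x ^ 5 * (1 - 11 * x - x ^ 2)) =
      x ^ 6 * ((t ^ 2 + 10 * t + 5) ^ 3 - j * t) := by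
  have h1 : x ^ 4 + 12 * x ^ 3 + 14 * x ^ 2 - 12 * x + 1 = x ^ 2 * (t ^ 2 + 10 * t + 5) := by
    linear_combination (x ^ 2 + (1 - t) * x - 1) * h
  have h2 : 1 - 11 * x - x ^ 2 = x * t := by linear_combination -h
  rw [h1, h2]
  ring

theorem eq_or_eq_of_sextic_eq_zero {F : Type*} [Field F] (h5 : (5 : F) ≠ 0)
    {e w r c j t : F} (he : e ^ 2 + e = 1) (hns : ¬ IsSquare (e - 2)) (hns' : ¬ IsSquare (-3 - e))
    (hr : r ≠ 0) (hw : w * r = r ^ 2 - 1) (hc : c = w ^ 5 + 5 * w ^ 3 + 5 * w - 11) (hc0 : c ≠ 0)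
    (hj0 : j ≠ 0) (hj1728 : j ≠ 1728) (hj : j * c ^ 5 = (3125 + 250 * c + c ^ 2) ^ 3)
    (ht : (t ^ 2 + 10 * t + 5) ^ 3 - j * t = 0) :
    c * t = 125 ∨ c * t = (w - 1) ^ 6 := by
  have key : ∀ d : F, d ^ 2 + d = 1 → ¬ IsSquare (-3 - d) →
      sixthPowerQuadratic w d (c * t) = 0 → False := by
    intro d hd hnsd hQ
    obtain ⟨s, hs⟩ : ∃ s, s = d * w - 2 := ⟨_, rfl⟩
    obtain ⟨p, hp⟩ : ∃ p, p = w ^ 2 + 4 + d - d * w := ⟨_, rfl⟩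
    have hQ' : (c * t) ^ 2 - sixthPowerSum s p * (c * t) + p ^ 6 = 0 := by
      rw [hs, hp]
      exact hQ
    have hsp : (s ^ 2 - 4 * p) * r ^ 2 = (-3 - d) * (r ^ 2 + 1) ^ 2 := by
      rw [hs, hp]
      linear_combination ((w ^ 2 + 0) * r ^ 2) * hd + (-3 - d) * (w * r + r ^ 2 - 1) * hw
    obtain ⟨m, hm⟩ : ∃ m, m = s * (s ^ 2 - p) * (s ^ 2 - 3 * p) * (r ^ 2 + 1) := ⟨_, rfl⟩
    have hdisc : (r * (2 * (c * t) - sixthPowerSum s p)) ^ 2 = (-3 - d) * m ^ 2 := by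
      rw [hm]
      rw [sixthPowerSum] at hQ' ⊢
      linear_combination 4 * r ^ 2 * hQ' + (s * (s ^ 2 - p) * (s ^ 2 - 3 * p)) ^ 2 * hsp
    have hm0 : m = 0 := by
      by_contra hm0
      apply hnsd
      refine ⟨r * (2 * (c * t) - sixthPowerSum s p) / m, ?_⟩
      field_simp
      linear_combination -hdisc
    have hT : 2 * (c * t) = sixthPowerSum s p := by
      rw [hm0] at hdisc
      have : r * (2 * (c * t) - sixthPowerSum s p) = 0 := by
        apply pow_eq_zero_iff (two_ne_zero) |>.1
        simpa using hdisc
      linear_combination (mul_eq_zero.1 this).resolve_left hr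
    have hpt : p ^ 6 = (c * t) ^ 2 := by
      rw [← hT] at hQ'
      linear_combination hQ'
    have hpoly : sixthPowerQuadratic (C w) (C d) X = (X - C (c * t)) ^ 2 := by
      have h1 : sixthPowerQuadratic (C w) (C d) X =
          X ^ 2 - C (sixthPowerSum s p) * X + C (p ^ 6) := by
        rw [hs, hp]
        simp [sixthPowerQuadratic, sixthPowerSum, map_ofNat]
      rw [h1, ← hT, hpt]
      simp only [C_mul, C_pow, map_ofNat]
      ring
    have hid := sixthPowerQuadratic_mul (R := F[X]) (e := C d)
      (by rw [← C_pow, ← C_add, hd, C_1]) (C w) X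
    have hCc : (C w : F[X]) ^ 5 + 5 * C w ^ 3 + 5 * C w - 11 = C c := by
      rw [hc]
      simp [map_ofNat]
    rw [hCc] at hid
    apply hj1728
    apply mul_right_cancel₀ (pow_ne_zero 5 hc0)
    apply eq_mul_pow_five_of_sq_mul h5 (mul_ne_zero hj0 (pow_ne_zero 5 hc0)) (c := c)
      (τ := c * t) (R := (X - 125) * (X - (C w - 1) ^ 6) * sixthPowerQuadratic (C w) (-1 - C d) X)
    rw [hj]
    rw [hpoly] at hid
    simp only [C_add, C_mul, C_pow, map_ofNat] at hid ⊢
    linear_combination -hid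
  have hid := sixthPowerQuadratic_mul he w (c * t)
  rw [← hc, ← hj] at hid
  have hz : (c * t - 125) * (c * t - (w - 1) ^ 6) *
      (sixthPowerQuadratic w e (c * t) * sixthPowerQuadratic w (-1 - e) (c * t)) = 0 := by
    linear_combination hid + c ^ 6 * ht
  rcases mul_eq_zero.1 hz with h | h
  · rcases mul_eq_zero.1 h with h | h
    · exact Or.inl (sub_eq_zero.1 h)
    · exact Or.inr (sub_eq_zero.1 h)
  · exfalso
    rcases mul_eq_zero.1 h with h | h
    · exact key e he hns' h
    · refine key (-1 - e) (by linear_combination he) ?_ h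
      rwa [show -3 - (-1 - e) = e - 2 by ring]

theorem sub_one_pow_six_ne {F : Type*} [Field F] (h5 : (5 : F) ≠ 0)
    {e w c j : F} (he : e ^ 2 + e = 1)
    (hc : c = w ^ 5 + 5 * w ^ 3 + 5 * w - 11) (hc0 : c ≠ 0)
    (hj0 : j ≠ 0) (hj1728 : j ≠ 1728) (hj : j * c ^ 5 = (3125 + 250 * c + c ^ 2) ^ 3) :
    (w - 1) ^ 6 ≠ 125 := by
  intro h
  have hid := sixthPowerQuadratic_mul (R := F[X]) (e := C e)
    (by rw [← C_pow, ← C_add, he, C_1]) (C w) X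
  have hCc : (C w : F[X]) ^ 5 + 5 * C w ^ 3 + 5 * C w - 11 = C c := by
    rw [hc]
    simp [map_ofNat]
  have h' : (C w - 1 : F[X]) ^ 6 = 125 := by
    rw [← C_1, ← C_sub, ← C_pow, h, map_ofNat]
  rw [hCc, h'] at hid
  apply hj1728
  apply mul_right_cancel₀ (pow_ne_zero 5 hc0)
  apply eq_mul_pow_five_of_sq_mul h5 (mul_ne_zero hj0 (pow_ne_zero 5 hc0)) (c := c)
    (τ := 125) (R := sixthPowerQuadratic (C w) (C e) X * sixthPowerQuadratic (C w) (-1 - C e) X)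
  rw [hj]
  simp only [C_add, C_mul, C_pow, map_ofNat]
  linear_combination -hid

theorem exists_fifth_root_param {l : ℕ} [Fact l.Prime] (hl5 : l % 5 = 4) (h2 : (2 : ZMod l) ≠ 0)
    (h5 : (5 : ZMod l) ≠ 0) {e : ZMod l} (he : e ^ 2 + e = 1) {x t : ZMod l} (hx : x ≠ 0)
    (ht : t ≠ 0) (hxt : x ^ 2 + (t + 11) * x = 1) :
    ∃ r w c : ZMod l, r ≠ 0 ∧ w * r = r ^ 2 - 1 ∧ c = w ^ 5 + 5 * w ^ 3 + 5 * w - 11 ∧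
      c * t = 125 := by
  obtain ⟨c, hc⟩ : ∃ c : ZMod l, c * t = 125 := ⟨125 / t, by field_simp⟩
  obtain ⟨d, hd⟩ : ∃ d : ZMod l, d * (x * t) = 5 * (2 * e + 1) * (x ^ 2 + 1) :=
    ⟨5 * (2 * e + 1) * (x ^ 2 + 1) / (x * t), by field_simp⟩
  have hd2 : d ^ 2 = (c + 11) ^ 2 + 4 := by
    have h1 : (x ^ 2 + 1) ^ 2 = x ^ 2 * (t ^ 2 + 22 * t + 125) := by
      linear_combination (x ^ 2 - 1 - (t + 11) * x) * hxt
    apply mul_right_cancel₀ (pow_ne_zero 2 (mul_ne_zero hx ht))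
    linear_combination (d * (x * t) + 5 * (2 * e + 1) * (x ^ 2 + 1)) * hd +
      100 * (x ^ 2 + 1) ^ 2 * he + 125 * h1 - x ^ 2 * (c * t + 125 + 22 * t) * hc
  obtain ⟨y, hy⟩ : ∃ y : ZMod l, 2 * y = c + 11 + d := ⟨(c + 11 + d) / 2, by field_simp⟩
  have hy2 : y ^ 2 - (c + 11) * y = 1 := by
    apply mul_left_cancel₀ (mul_ne_zero h2 h2)
    linear_combination (2 * y - (c + 11) + d) * hy + hd2
  have hy0 : y ≠ 0 := by
    rintro rfl
    simp at hy2
  obtain ⟨r, rfl⟩ := exists_pow_five_eq hl5 hy0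
  have hr : r ≠ 0 := by
    rintro rfl
    simp at hy0
  refine ⟨r, r - r⁻¹, c, hr, ?_, ?_, hc⟩
  · field_simp
  · field_simp
    linear_combination -hy2

theorem sextic_eq_zero_of_mul_eq {F : Type*} [Field F] {c j T t : F} (hc0 : c ≠ 0)
    (hj : j * c ^ 5 = (3125 + 250 * c + c ^ 2) ^ 3) (ht : c * t = T)
    (hT : (T ^ 2 + 10 * c * T + 5 * c ^ 2) ^ 3 = (3125 + 250 * c + c ^ 2) ^ 3 * T) :
    (t ^ 2 + 10 * t + 5) ^ 3 - j * t = 0 := by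
  subst ht
  apply (mul_eq_zero.1 _).resolve_left (pow_ne_zero 6 hc0)
  linear_combination hT - c * t * hj

theorem root_ne_neg_inv {F : Type*} [Field F] {j x t : F} (hj1728 : j ≠ 1728) (ht0 : t ≠ 0)
    (hx : x ≠ 0) (hxt : x ^ 2 + (t + 11) * x = 1)
    (ht : (t ^ 2 + 10 * t + 5) ^ 3 - j * t = 0) : x ≠ -x⁻¹ := by
  intro h
  have h1 : x ^ 2 = -1 := by
    field_simp at h
    exact h
  have h2 : t ^ 2 + 22 * t + 125 = 0 := by
    apply (mul_eq_zero.1 _).resolve_left (pow_ne_zero 2 hx)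
    linear_combination -(x ^ 2 - 1 - (t + 11) * x) * hxt + (x ^ 2 + 1) * h1
  apply hj1728
  apply mul_right_cancel₀ ht0
  linear_combination (t ^ 2 + 4 * t - 1) ^ 2 * h2 - ht

theorem eq_or_eq_neg_inv {F : Type*} [Field F] {x y t : F} (hx : x ≠ 0)
    (hxt : x ^ 2 + (t + 11) * x = 1) (hyt : y ^ 2 + (t + 11) * y = 1) :
    y = x ∨ y = -x⁻¹ := by
  have : (y - x) * (y - -x⁻¹) = 0 := by
    field_simp
    linear_combination x * hyt - y * hxt
  rcases mul_eq_zero.1 this with h | h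
  · exact Or.inl (sub_eq_zero.1 h)
  · exact Or.inr (sub_eq_zero.1 h)

theorem neg_inv_sq_add {F : Type*} [Field F] {x t : F} (hx : x ≠ 0)
    (hxt : x ^ 2 + (t + 11) * x = 1) : (-x⁻¹) ^ 2 + (t + 11) * (-x⁻¹) = 1 := by
  field_simp
  linear_combination -hxt

theorem card_roots_eq_four_of_root {l : ℕ} [Fact l.Prime] (hl5 : l % 5 = 4) (hl2 : l ≠ 2)
    {j : ZMod l} (hj0 : j ≠ 0) (hj1728 : j ≠ 1728) {x : ZMod l}
    (hroot : (x ^ 4 + 12 * x ^ 3 + 14 * x ^ 2 - 12 * x + 1) ^ 3 -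
      j * (x ^ 5 * (1 - 11 * x - x ^ 2)) = 0) :
    (((X ^ 4 + 12 * X ^ 3 + 14 * X ^ 2 - 12 * X + 1) ^ 3 -
        C j * (X ^ 5 * (1 - 11 * X - X ^ 2)) : Polynomial (ZMod l))).roots.toFinset.card = 4 := by
  have hlp : l.Prime := Fact.out
  have h2 : (2 : ZMod l) ≠ 0 := by
    intro h0
    have h0' : ((2 : ℕ) : ZMod l) = 0 := by exact_mod_cast h0
    rw [ZMod.natCast_eq_zero_iff] at h0'
    exact hl2 ((Nat.prime_dvd_prime_iff_eq hlp Nat.prime_two).1 h0')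
  have h5 : (5 : ZMod l) ≠ 0 := by
    intro h0
    have h0' : ((5 : ℕ) : ZMod l) = 0 := by exact_mod_cast h0
    rw [ZMod.natCast_eq_zero_iff] at h0'
    have := (Nat.prime_dvd_prime_iff_eq hlp Nat.prime_five).1 h0'
    omega
  have h125 : (125 : ZMod l) ≠ 0 := by
    rw [show (125 : ZMod l) = 5 ^ 3 by norm_num]
    exact pow_ne_zero 3 h5
  obtain ⟨e, he⟩ := exists_sq_add_self_eq_one hl5 hl2
  have hns := not_isSquare_sub_two hl5 h2 h5 he
  have hns' : ¬ IsSquare (-3 - e) := by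
    have := not_isSquare_sub_two (e := -1 - e) hl5 h2 h5 (by linear_combination he)
    rwa [show -1 - e - 2 = -3 - e by ring] at this
  have exists_t : ∀ y : ZMod l, y ≠ 0 → ∃ t, y ^ 2 + (t + 11) * y = 1 := fun y hy =>
    ⟨(1 - y ^ 2) / y - 11, by field_simp; ring⟩
  have hne0 : ∀ y : ZMod l, (y ^ 4 + 12 * y ^ 3 + 14 * y ^ 2 - 12 * y + 1) ^ 3 -
      j * (y ^ 5 * (1 - 11 * y - y ^ 2)) = 0 → y ≠ 0 := by
    rintro y hy rfl
    simp at hy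
  have hsext : ∀ y t : ZMod l, y ≠ 0 → y ^ 2 + (t + 11) * y = 1 →
      (y ^ 4 + 12 * y ^ 3 + 14 * y ^ 2 - 12 * y + 1) ^ 3 -
        j * (y ^ 5 * (1 - 11 * y - y ^ 2)) = 0 → (t ^ 2 + 10 * t + 5) ^ 3 - j * t = 0 := by
    intro y t hy hyt h
    rw [quintic_eq_sextic j hyt] at h
    exact (mul_eq_zero.1 h).resolve_left (pow_ne_zero 6 hy)
  have hx := hne0 x hroot
  obtain ⟨t, hxt⟩ := exists_t x hx
  have ht := hsext x t hx hxt hroot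
  have ht_ne : ∀ t : ZMod l, (t ^ 2 + 10 * t + 5) ^ 3 - j * t = 0 → t ≠ 0 := by
    rintro t ht rfl
    apply h125
    linear_combination ht
  obtain ⟨r, w, c, hr, hw, hc, hct⟩ := exists_fifth_root_param hl5 h2 h5 he hx (ht_ne t ht) hxt
  have hc0 : c ≠ 0 := by
    rintro rfl
    apply h125
    linear_combination -hct
  have hj : j * c ^ 5 = (3125 + 250 * c + c ^ 2) ^ 3 := by
    apply mul_left_cancel₀ h125
    have h1 : c ^ 2 * (t ^ 2 + 10 * t + 5) = 5 * (3125 + 250 * c + c ^ 2) := by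
      linear_combination (c * t + 125 + 10 * c) * hct
    have h3 : (c ^ 2 * (t ^ 2 + 10 * t + 5)) ^ 3 = j * c ^ 5 * 125 := by
      linear_combination c ^ 6 * ht + j * c ^ 5 * hct
    rw [h1] at h3
    linear_combination -h3
  obtain ⟨t', hct'⟩ : ∃ t', c * t' = (w - 1) ^ 6 := ⟨(w - 1) ^ 6 / c, by field_simp⟩
  have htt' : t' ≠ t := by
    rintro rfl
    exact sub_one_pow_six_ne h5 he hc hc0 hj0 hj1728 hj (hct'.symm.trans hct)
  have ht' : (t' ^ 2 + 10 * t' + 5) ^ 3 - j * t' = 0 := by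
    apply sextic_eq_zero_of_mul_eq hc0 hj hct'
    have := sixthPowerQuadratic_mul he w ((w - 1) ^ 6)
    rw [← hc, sub_self, mul_zero, zero_mul] at this
    exact (sub_eq_zero.1 this.symm)
  have ht0' := ht_ne t' ht'
  obtain ⟨z, hz⟩ : ∃ z, z = w - 1 := ⟨_, rfl⟩
  have hcz : c = z * (z ^ 4 + 5 * z ^ 3 + 15 * z ^ 2 + 25 * z + 25) := by
    rw [hc, hz]
    ring
  obtain ⟨q, hq⟩ : ∃ q, q = z ^ 4 + 5 * z ^ 3 + 15 * z ^ 2 + 25 * z + 25 := ⟨_, rfl⟩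
  rw [← hq] at hcz
  have hz0 : z ≠ 0 := by
    rintro rfl
    simp [hcz] at hc0
  have hqt : q * t' = z ^ 5 := by
    apply mul_left_cancel₀ hz0
    rw [← hz, hcz] at hct'
    linear_combination hct'
  have hq0 : q ≠ 0 := by
    rintro rfl
    simp [hcz] at hc0
  obtain ⟨d, hd⟩ : ∃ d : ZMod l, d ^ 2 = (t' + 11) ^ 2 + 4 := by
    refine ⟨(r ^ 2 + 1) * (z ^ 4 + 10 * z ^ 3 + 45 * z ^ 2 + 100 * z + 125) / (r * q), ?_⟩
    have hwr : (r ^ 2 + 1) ^ 2 = r ^ 2 * (z ^ 2 + 2 * z + 5) := by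
      rw [hz]
      linear_combination - (w * r + r ^ 2 - 1) * hw
    have hid : z ^ 10 + 22 * z ^ 5 * q + 125 * q ^ 2 =
        (z ^ 2 + 2 * z + 5) * (z ^ 4 + 10 * z ^ 3 + 45 * z ^ 2 + 100 * z + 125) ^ 2 := by
      rw [hq]
      ring
    field_simp
    rw [hwr]
    linear_combination -r ^ 2 * (q * t' + z ^ 5 + 22 * q) * hqt - r ^ 2 * hid
  obtain ⟨x', hx'⟩ : ∃ x' : ZMod l, 2 * x' = -(t' + 11) + d :=
    ⟨(-(t' + 11) + d) / 2, by field_simp⟩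
  have hxt' : x' ^ 2 + (t' + 11) * x' = 1 := by
    apply mul_left_cancel₀ (mul_ne_zero h2 h2)
    linear_combination (2 * x' + (t' + 11) + d) * hx' + hd
  have hx'0 : x' ≠ 0 := by
    rintro rfl
    simp at hxt'
  have hxt_inv := neg_inv_sq_add hx hxt
  have hxt_inv' := neg_inv_sq_add hx'0 hxt'
  have hdist : ∀ y y' : ZMod l, y ^ 2 + (t + 11) * y = 1 → y' ^ 2 + (t' + 11) * y' = 1 →
      y' ≠ 0 → y ≠ y' := by
    rintro y _ h h' h0 rfl
    exact htt' (add_right_cancel (mul_right_cancel₀ h0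
      (add_left_cancel (h'.trans h.symm))))
  have hf0 : ((X ^ 4 + 12 * X ^ 3 + 14 * X ^ 2 - 12 * X + 1) ^ 3 -
      C j * (X ^ 5 * (1 - 11 * X - X ^ 2)) : Polynomial (ZMod l)) ≠ 0 := by
    intro h
    have := congrArg (eval 0) h
    simp at this
  have hset : (((X ^ 4 + 12 * X ^ 3 + 14 * X ^ 2 - 12 * X + 1) ^ 3 -
      C j * (X ^ 5 * (1 - 11 * X - X ^ 2)) : Polynomial (ZMod l))).roots.toFinset =
      {x, -x⁻¹, x', -x'⁻¹} := by
    ext y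
    rw [Multiset.mem_toFinset, mem_roots hf0, IsRoot.def]
    simp only [eval_sub, eval_pow, eval_add, eval_mul, eval_X, eval_C, eval_one, eval_ofNat,
      Finset.mem_insert, Finset.mem_singleton]
    constructor
    · intro hy
      have hy0 := hne0 y hy
      obtain ⟨u, hyu⟩ := exists_t y hy0
      have hu := hsext y u hy0 hyu hy
      rcases eq_or_eq_of_sextic_eq_zero h5 he hns hns' hr hw hc hc0 hj0 hj1728 hj hu with h | h
      · have : u = t := mul_left_cancel₀ hc0 (h.trans hct.symm)
        subst this
        rcases eq_or_eq_neg_inv hx hxt hyu with h | h <;> simp [h]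
      · have : u = t' := mul_left_cancel₀ hc0 (h.trans hct'.symm)
        subst this
        rcases eq_or_eq_neg_inv hx'0 hxt' hyu with h | h <;> simp [h]
    · rintro (rfl | rfl | rfl | rfl)
      · exact hroot
      · rw [quintic_eq_sextic j hxt_inv, ht, mul_zero]
      · rw [quintic_eq_sextic j hxt', ht', mul_zero]
      · rw [quintic_eq_sextic j hxt_inv', ht', mul_zero]
  have hinv0 : -x'⁻¹ ≠ 0 := neg_ne_zero.2 (inv_ne_zero hx'0)
  rw [hset, Finset.card_insert_of_notMem, Finset.card_insert_of_notMem,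
    Finset.card_insert_of_notMem, Finset.card_singleton]
  · simpa using root_ne_neg_inv hj1728 ht0' hx'0 hxt' ht'
  · simp only [Finset.mem_insert, Finset.mem_singleton, not_or]
    exact ⟨hdist _ _ hxt_inv hxt' hx'0, hdist _ _ hxt_inv hxt_inv' hinv0⟩
  · simp only [Finset.mem_insert, Finset.mem_singleton, not_or]
    exact ⟨root_ne_neg_inv hj1728 (ht_ne t ht) hx hxt ht, hdist _ _ hxt hxt' hx'0,
      hdist _ _ hxt hxt_inv' hinv0⟩

/-- The Weierstrass curve `y ^ 2 = x ^ 3 + a * x + b`. -/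
def shortWeierstrass {F : Type*} [CommRing F] (a b : F) : WeierstrassCurve.Affine F :=
  ⟨0, 0, 0, a, b⟩

open WeierstrassCurve.Affine in
theorem exists_five_division_relation {F : Type*} [Field F] [DecidableEq F] {a b : F}
    (P : (shortWeierstrass a b).Point) (hP : P ≠ 0) (h5 : 5 • P = 0) :
    ∃ p q m A : F, q ≠ 0 ∧ A ≠ 0 ∧ q ^ 2 = p ^ 3 + a * p + b ∧ 2 * q * m = 3 * p ^ 2 + a ∧
      A = 3 * p - m ^ 2 ∧ 4 * q ^ 2 + A ^ 3 = 4 * q * m * A := by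
  obtain _ | ⟨p, q, h⟩ := P
  · exact absurd rfl hP
  set P : (shortWeierstrass a b).Point := .some p q h with hPdef
  have h2P : P + P ≠ 0 := by
    intro h0
    apply hP
    calc P = 5 • P - 2 • (P + P) := by abel
      _ = 0 := by rw [h5, h0, smul_zero, sub_zero]
  have h3P : P + P ≠ -P := by
    intro h0
    apply hP
    calc P = 2 • (P + P - -P) - 5 • P := by abel
      _ = 0 := by rw [h5, h0, sub_self, smul_zero, sub_zero]
  have hneg : (shortWeierstrass a b).negY p q = -q := by
    simp [negY, shortWeierstrass]
  have hq : q ≠ (shortWeierstrass a b).negY p q := by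
    intro hq
    exact h2P (Point.add_self_of_Y_eq hq)
  have hqq : 2 * q ≠ 0 := by
    intro h0
    apply hq
    rw [hneg]
    linear_combination h0
  have hq0 : q ≠ 0 := right_ne_zero_of_mul hqq
  have hsl : (shortWeierstrass a b).slope p p q q = (3 * p ^ 2 + a) / (2 * q) := by
    rw [slope_of_Y_ne rfl hq, hneg]
    simp [shortWeierstrass]
    ring
  obtain ⟨m, hm⟩ : ∃ m, m = (3 * p ^ 2 + a) / (2 * q) := ⟨_, rfl⟩
  rw [← hm] at hsl
  have hadd := Point.add_self_of_Y_ne (h₁ := h) hq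
  rw [← hPdef] at hadd
  obtain ⟨p2, hp2⟩ : ∃ x, x = m ^ 2 - 2 * p := ⟨_, rfl⟩
  obtain ⟨q2, hq2⟩ : ∃ y, y = -(q + m * (p2 - p)) := ⟨_, rfl⟩
  have hX : (shortWeierstrass a b).addX p p ((shortWeierstrass a b).slope p p q q) = p2 := by
    rw [hsl, hp2]
    simp [addX, shortWeierstrass]
    ring
  have hY : (shortWeierstrass a b).addY p p q ((shortWeierstrass a b).slope p p q q) = q2 := by
    rw [addY, negAddY, hX, hsl, hq2]
    simp [negY, shortWeierstrass]
    ring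
  have hns : (shortWeierstrass a b).Nonsingular p2 q2 := by
    rw [← hX, ← hY]
    exact nonsingular_add h h (fun h' => hq h'.2)
  have h2 : P + P = .some p2 q2 hns := by
    rw [hadd]
    simp only [Point.some.injEq]
    exact ⟨hX, hY⟩
  have hne : p2 ≠ p := by
    intro heq
    have := (Point.xRep_eq_xRep_iff (P := P + P) (Q := P)).1
      (by rw [h2, hPdef, Point.xRep_some, Point.xRep_some, heq])
    rcases this with h' | h'
    · exact hP (by simpa only [add_eq_right] using h')
    · exact h3P h'
  have h3 := Point.add_of_X_ne (h₁ := hns) (h₂ := h) hne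
  rw [← h2, ← hPdef] at h3
  have h32 : P + P + P = -(P + P) := by
    rw [← sub_eq_zero, ← h5]
    abel
  have hx : (shortWeierstrass a b).addX p2 p ((shortWeierstrass a b).slope p2 p q2 q) = p2 := by
    have := h3.symm.trans h32
    rw [h2, Point.neg_some] at this
    simp only [Point.some.injEq] at this
    exact this.1
  rw [slope_of_X_ne hne] at hx
  simp only [addX, shortWeierstrass, zero_mul, add_zero, sub_zero] at hx
  have hpp : p2 - p ≠ 0 := sub_ne_zero.2 hne
  refine ⟨p, q, m, 3 * p - m ^ 2, hq0, ?_, ?_, ?_, rfl, ?_⟩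
  · intro h0
    apply hpp
    linear_combination hp2 - h0
  · have := (equation_iff p q).1 h.1
    simpa [shortWeierstrass] using this
  · rw [hm, mul_div_cancel₀ _ hqq]
  · have hA : 3 * p - m ^ 2 = p - p2 := by rw [hp2]; ring
    rw [hA]
    field_simp at hx
    subst hq2
    have hm2 : m ^ 2 = p2 + 2 * p := by rw [hp2]; ring
    linear_combination hx - (p2 - p) ^ 2 * hm2

theorem exists_root_of_five_torsion {F : Type*} [Field F] [DecidableEq F] (h2 : (2 : F) ≠ 0)
    (h3 : (3 : F) ≠ 0) {a b j : F} (hj : j * (4 * a ^ 3 + 27 * b ^ 2) = 6912 * a ^ 3)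
    (P : (shortWeierstrass a b).Point) (hP : P ≠ 0) (h5 : 5 • P = 0) :
    ∃ x : F, (x ^ 4 + 12 * x ^ 3 + 14 * x ^ 2 - 12 * x + 1) ^ 3 -
      j * (x ^ 5 * (1 - 11 * x - x ^ 2)) = 0 := by
  obtain ⟨p, q, m, A, hq, hA, hcurve, hm, hAp, hrel⟩ := exists_five_division_relation P hP h5
  obtain ⟨g, hg⟩ : ∃ g, g * A = q := ⟨q / A, by field_simp⟩
  have hg0 : g ≠ 0 := by
    rintro rfl
    simp [eq_comm, hq] at hg
  have h4 : (4 : F) ≠ 0 := by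
    rw [show (4 : F) = 2 * 2 by norm_num]
    exact mul_ne_zero h2 h2
  obtain ⟨x, hx⟩ : ∃ x, 4 * g ^ 2 * x = A := ⟨A / (4 * g ^ 2), by field_simp⟩
  have hq' : q = 4 * g ^ 3 * x := by rw [← hg, ← hx]; ring
  have hx0 : x ≠ 0 := by
    rintro rfl
    simp [hq] at hq'
  have hm' : m = g * (1 + x) := by
    apply mul_left_cancel₀ (mul_ne_zero (mul_ne_zero h4 hq) hA)
    rw [hq'] at hrel ⊢
    rw [← hx] at hrel ⊢
    linear_combination -hrel
  obtain ⟨d, hd⟩ : ∃ d : F, 3 * d = g ^ 2 := ⟨g ^ 2 / 3, by field_simp⟩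
  have hp : p = d * (x ^ 2 + 6 * x + 1) := by
    apply mul_left_cancel₀ h3
    rw [← hx, hm'] at hAp
    linear_combination -hAp - (x ^ 2 + 6 * x + 1) * hd
  have ha : a = -3 * d ^ 2 * (x ^ 4 + 12 * x ^ 3 + 14 * x ^ 2 - 12 * x + 1) := by
    rw [hq', hm', hp] at hm
    linear_combination -hm + 8 * x * (1 + x) * (-g ^ 2 - 3 * d) * hd
  have hb : b = 2 * d ^ 3 * (x ^ 2 + 1) * (x ^ 4 + 18 * x ^ 3 + 74 * x ^ 2 - 18 * x + 1) := by
    rw [hp, ha, hq'] at hcurve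
    linear_combination -hcurve + 16 * x ^ 2 * (-g ^ 4 - 3 * d * g ^ 2 - 9 * d ^ 2) * hd
  refine ⟨x, ?_⟩
  have hd0 : d ≠ 0 := by
    rintro rfl
    exact pow_ne_zero 2 hg0 (by rw [← hd, mul_zero])
  have hne : (108 : F) * d ^ 6 ≠ 0 := by
    rw [show (108 : F) = 2 ^ 2 * 3 ^ 3 by norm_num]
    exact mul_ne_zero (mul_ne_zero (pow_ne_zero _ h2) (pow_ne_zero _ h3)) (pow_ne_zero _ hd0)
  have h1728 : (1728 : F) ≠ 0 := by
    rw [show (1728 : F) = 2 ^ 6 * 3 ^ 3 by norm_num]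
    exact mul_ne_zero (pow_ne_zero _ h2) (pow_ne_zero _ h3)
  apply (mul_eq_zero.1 _).resolve_left (mul_ne_zero hne h1728)
  rw [ha, hb] at hj
  linear_combination hj

theorem card_shortWeierstrass_point {F : Type*} [Field F] [Fintype F] [DecidableEq F]
    (hF : ringChar F ≠ 2) {a b : F} (hΔ : (shortWeierstrass a b).Δ ≠ 0) :
    (Nat.card (shortWeierstrass a b).Point : ℤ) =
      Fintype.card F + 1 + ∑ x : F, quadraticChar F (x ^ 3 + a * x + b) := by
  have heq : ∀ x y : F, (shortWeierstrass a b).Nonsingular x y ↔ y ^ 2 = x ^ 3 + a * x + b := by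
    intro x y
    rw [← WeierstrassCurve.Affine.equation_iff_nonsingular_of_Δ_ne_zero hΔ,
      WeierstrassCurve.Affine.equation_iff]
    simp [shortWeierstrass]
  have h1 : Nat.card (shortWeierstrass a b).Point =
      Nat.card {xy : F × F // xy.2 ^ 2 = xy.1 ^ 3 + a * xy.1 + b} + 1 := by
    rw [← Finite.card_option]
    exact Nat.card_congr ((WeierstrassCurve.Affine.nonsingularPointEquiv _).trans
      (Equiv.subtypeEquivRight fun xy : F × F => heq xy.1 xy.2).optionCongr)
  have h2 : Nat.card {xy : F × F // xy.2 ^ 2 = xy.1 ^ 3 + a * xy.1 + b} =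
      ∑ x : F, {y : F | y ^ 2 = x ^ 3 + a * x + b}.toFinset.card := by
    rw [Nat.card_eq_fintype_card, Fintype.card_subtype, Finset.card_filter,
      Fintype.sum_prod_type]
    refine Finset.sum_congr rfl fun x _ => ?_
    rw [← Finset.card_filter]
    congr 1
    ext y
    simp
  rw [h1, h2]
  push_cast
  simp_rw [quadraticChar_card_sqrts hF]
  rw [Finset.sum_add_distrib]
  simp
  ring

theorem exists_root_of_sum_quadraticChar_eq_zero {F : Type*} [Field F] [Fintype F] [DecidableEq F]
    (h2 : (2 : F) ≠ 0) (h3 : (3 : F) ≠ 0) (h5 : 5 ∣ Fintype.card F + 1) {a b j : F}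
    (hΔ : 4 * a ^ 3 + 27 * b ^ 2 ≠ 0) (hj : j * (4 * a ^ 3 + 27 * b ^ 2) = 6912 * a ^ 3)
    (hsum : ∑ x : F, quadraticChar F (x ^ 3 + a * x + b) = 0) :
    ∃ x : F, (x ^ 4 + 12 * x ^ 3 + 14 * x ^ 2 - 12 * x + 1) ^ 3 -
      j * (x ^ 5 * (1 - 11 * x - x ^ 2)) = 0 := by
  have hF : ringChar F ≠ 2 := by
    intro h
    apply h2
    have := ringChar.Nat.cast_ringChar (R := F)
    rw [h] at this
    exact_mod_cast this
  have hΔ' : (shortWeierstrass a b).Δ ≠ 0 := by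
    have : (shortWeierstrass a b).Δ = -(2 ^ 4) * (4 * a ^ 3 + 27 * b ^ 2) := by
      simp [WeierstrassCurve.Δ, WeierstrassCurve.b₂, WeierstrassCurve.b₄, WeierstrassCurve.b₆,
        WeierstrassCurve.b₈, shortWeierstrass]
      ring
    rw [this]
    exact mul_ne_zero (neg_ne_zero.2 (pow_ne_zero _ h2)) hΔ
  have hcard := card_shortWeierstrass_point hF hΔ'
  rw [hsum, add_zero] at hcard
  have hcard' : Nat.card (shortWeierstrass a b).Point = Fintype.card F + 1 := by
    exact_mod_cast hcard
  have : Finite (shortWeierstrass a b).Point := Nat.finite_of_card_ne_zero (by omega)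
  have : Fact (Nat.Prime 5) := ⟨Nat.prime_five⟩
  obtain ⟨P, hP⟩ := exists_prime_addOrderOf_dvd_card' (G := (shortWeierstrass a b).Point) 5
    (by rw [hcard']; exact h5)
  refine exists_root_of_five_torsion h2 h3 hj P ?_ ?_
  · rintro rfl
    simp at hP
  · rw [← hP, addOrderOf_nsmul_eq_zero]

theorem exists_eval_pow_half_ne {l : ℕ} [Fact l.Prime] (hl : 3 < l) (a b : ZMod l) {ε : ZMod l}
    (hε : ε ≠ 0) : ∃ x : ZMod l, (x ^ 3 + a * x + b) ^ (l / 2) ≠ ε := by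
  by_contra! hall
  have hlp : l.Prime := Fact.out
  have hodd : l = 2 * (l / 2) + 1 := by
    have := hlp.eq_two_or_odd
    omega
  set m := l / 2 with hm
  have cast_ne : ∀ n : ℕ, 0 < n → n < l → (n : ZMod l) ≠ 0 := by
    intro n h0 hn h
    rw [ZMod.natCast_eq_zero_iff] at h
    exact absurd (Nat.le_of_dvd h0 h) (by omega)
  have hm0 : (m : ZMod l) ≠ 0 := cast_ne m (by omega) (by omega)
  have h3 : (3 : ZMod l) ≠ 0 := by exact_mod_cast cast_ne 3 (by omega) (by omega)
  obtain ⟨f, hf⟩ : ∃ f : (ZMod l)[X], f = X ^ 3 + C a * X + C b := ⟨_, rfl⟩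
  have hfdeg : f.natDegree = 3 := by
    rw [hf]
    compute_degree!
  have hf' : derivative f = C 3 * X ^ 2 + C a := by
    rw [hf]
    simp [map_ofNat]
    norm_num
  have hf'deg : (derivative f).natDegree = 2 := by
    rw [hf']
    compute_degree!
  have hQmonic : (X ^ l - X : (ZMod l)[X]).Monic :=
    monic_X_pow_sub (by rw [degree_X]; exact_mod_cast hlp.one_lt)
  have hQdeg : (X ^ l - X : (ZMod l)[X]).natDegree = l :=
    FiniteField.X_pow_card_sub_X_natDegree_eq _ hlp.one_lt
  have hQeval : ∀ x : ZMod l, eval x (X ^ l - X : (ZMod l)[X]) = 0 := by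
    intro x
    simp [ZMod.pow_card]
  have hzero : ∀ p : (ZMod l)[X], (∀ x, eval x p = 0) → p.natDegree < l → p = 0 := by
    intro p hp hdeg
    apply eq_zero_of_natDegree_lt_card_of_eval_eq_zero' p Finset.univ (fun x _ => hp x)
    simpa [ZMod.card] using hdeg
  obtain ⟨g, hg⟩ : ∃ g, g = (f ^ m - C ε) /ₘ (X ^ l - X) := ⟨_, rfl⟩
  have hfm : f ^ m - C ε = (X ^ l - X) * g := by
    have hdiv := modByMonic_add_div (f ^ m - C ε) (X ^ l - X : (ZMod l)[X])
    have hr : (f ^ m - C ε) %ₘ (X ^ l - X) = 0 := by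
      apply hzero
      · intro x
        have := congrArg (eval x) hdiv
        rw [eval_add, eval_mul, hQeval, zero_mul, add_zero] at this
        rw [this, hf]
        simp [hall x]
      · have := natDegree_modByMonic_lt (f ^ m - C ε) hQmonic
          (fun h => by rw [h, natDegree_one] at hQdeg; omega)
        rwa [hQdeg] at this
    rw [hr, zero_add] at hdiv
    rw [hg, hdiv]
  have hgdeg : g.natDegree ≤ 3 * m - l := by
    rw [hg, natDegree_divByMonic _ hQmonic, hQdeg, natDegree_sub_C, natDegree_pow, hfdeg,
      mul_comm]
  have hder : C (m : ZMod l) * f ^ (m - 1) * derivative f =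
      - g + (X ^ l - X) * derivative g := by
    have := congrArg derivative hfm
    rw [derivative_sub, derivative_C, sub_zero, derivative_pow, derivative_mul, derivative_sub,
      derivative_pow, derivative_X] at this
    rw [this]
    simp
  have hfpow : f ^ (m - 1) * f = f ^ m := by
    rw [← pow_succ]
    congr 1
    omega
  have hmain : C ((m : ZMod l) * ε) * derivative f + f * g = 0 := by
    apply hzero
    · intro x
      have h1 := congrArg (eval x) hder
      have h2 := congrArg (eval x) hfm
      have h4 := congrArg (eval x) hfpow
      simp only [eval_mul, eval_add, eval_neg, eval_sub, eval_pow, eval_C] at h1 h2 h4 ⊢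
      have hQ := hQeval x
      rw [eval_sub, eval_pow, eval_X] at hQ
      rw [eval_X, hQ] at h1 h2
      linear_combination eval x f * h1 - m * eval x (derivative f) * h2 -
        m * eval x (derivative f) * h4
    · refine lt_of_le_of_lt (natDegree_add_le _ _) (max_lt ?_ ?_)
      · refine lt_of_le_of_lt (natDegree_C_mul_le _ _) ?_
        omega
      · refine lt_of_le_of_lt natDegree_mul_le ?_
        omega
  have hdvd : f ∣ C ((m : ZMod l) * ε) * derivative f :=
    ⟨-g, by linear_combination hmain⟩
  have hne : C ((m : ZMod l) * ε) * derivative f ≠ 0 := by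
    apply mul_ne_zero
    · rw [Ne, C_eq_zero]
      exact mul_ne_zero hm0 hε
    · intro h
      rw [h] at hf'deg
      simp at hf'deg
  have h1 := natDegree_le_of_dvd hdvd hne
  have h2 := natDegree_C_mul_le ((m : ZMod l) * ε) (derivative f)
  omega

theorem sum_quadraticChar_eq_zero {l : ℕ} [Fact l.Prime] (hl : 3 < l) (a b : ZMod l)
    (h : ∑ x : ZMod l, (x ^ 3 + a * x + b) ^ (l / 2) = 0) :
    ∑ x : ZMod l, quadraticChar (ZMod l) (x ^ 3 + a * x + b) = 0 := by
  have hchar : ringChar (ZMod l) ≠ 2 := by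
    rw [ZMod.ringChar_zmod_n]
    omega
  have hpow : ∀ x : ZMod l, (quadraticChar (ZMod l) x : ZMod l) = x ^ (l / 2) := by
    intro x
    have := quadraticChar_eq_pow_of_char_ne_two' hchar x
    rwa [ZMod.card] at this
  have hle : ∀ x : ZMod l, |quadraticChar (ZMod l) x| ≤ 1 := by
    intro x
    rcases quadraticChar_isQuadratic (ZMod l) x with h | h | h <;> rw [h] <;> norm_num
  have hdvd : (l : ℤ) ∣ ∑ x : ZMod l, quadraticChar (ZMod l) (x ^ 3 + a * x + b) := by
    rw [← ZMod.intCast_zmod_eq_zero_iff_dvd]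
    push_cast
    simp_rw [hpow]
    exact h
  apply Int.eq_zero_of_abs_lt_dvd hdvd
  have hcard : ∑ _x : ZMod l, (1 : ℤ) = l := by simp [ZMod.card]
  have hbound : ∀ ε : ℤ, ε = 1 ∨ ε = -1 →
      ∑ x : ZMod l, ε * quadraticChar (ZMod l) (x ^ 3 + a * x + b) < l := by
    intro ε hε
    rw [← hcard]
    have hle' : ∀ x ∈ (Finset.univ : Finset (ZMod l)),
        ε * quadraticChar (ZMod l) (x ^ 3 + a * x + b) ≤ 1 := by
      intro x _
      have := abs_le.1 (hle (x ^ 3 + a * x + b))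
      rcases hε with rfl | rfl <;> linarith
    refine lt_of_le_of_ne (Finset.sum_le_sum hle') fun heq => ?_
    have hall := (Finset.sum_eq_sum_iff_of_le hle').1 heq
    have hε0 : (ε : ZMod l) ≠ 0 := by rcases hε with rfl | rfl <;> simp
    obtain ⟨x, hx⟩ := exists_eval_pow_half_ne hl a b hε0
    apply hx
    rw [← hpow]
    congr 1
    have := hall x (Finset.mem_univ x)
    rcases hε with rfl | rfl <;> linarith
  have h1 := hbound 1 (Or.inl rfl)
  have h2 := hbound (-1) (Or.inr rfl)
  rw [← Finset.mul_sum] at h1 h2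
  rw [abs_lt]
  constructor <;> linarith

theorem coeff_X_mul_derivative {R : Type*} [CommRing R] (p : R[X]) (i : ℕ) :
    (X * derivative p).coeff i = i * p.coeff i := by
  cases i with
  | zero => simp
  | succ i =>
    rw [coeff_X_mul, coeff_derivative]
    push_cast
    ring

theorem taylor_one_coeff_recurrence {R : Type*} [CommRing R] {G : R[X]} {c d : R}
    (h : ∀ i : ℕ, 2 * (i + 1) ^ 2 * G.coeff (i + 1) = (2 * i ^ 2 - c * i + d) * G.coeff i) (i : ℕ) :
    (i + 1) * (c - 2 * i) * (taylor 1 G).coeff (i + 1) =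
      (2 * i ^ 2 - c * i + d) * (taylor 1 G).coeff i := by
  have hG : 2 * derivative (X * derivative G) =
      2 * (X * derivative (X * derivative G)) - C c * (X * derivative G) + C d * G := by
    ext i
    simp only [← C_ofNat (R := R) 2, coeff_add, coeff_sub, coeff_C_mul, coeff_X_mul_derivative,
      coeff_derivative]
    have := h i
    push_cast
    linear_combination this
  obtain ⟨P, hP⟩ : ∃ P, P = taylor 1 G := ⟨_, rfl⟩
  have hder : ∀ p : R[X], (derivative p).comp (X + 1) = derivative (p.comp (X + 1)) := by
    intro p
    simp [derivative_comp]
  have hPc : G.comp (X + 1) = P := by rw [hP, taylor_apply, C_1]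
  have hP2 := congrArg (fun p => p.comp (X + 1)) hG
  simp only [add_comp, sub_comp, mul_comp, C_comp, X_comp, hder, hPc, ofNat_comp] at hP2
  have hode : 2 * (X * derivative (X * derivative P)) + 2 * (X * derivative (derivative P)) -
      C c * (X * derivative P) - C c * derivative P + C d * P = 0 := by
    simp only [derivative_mul, derivative_add, derivative_X, derivative_one] at hP2 ⊢
    linear_combination -hP2
  have := congrArg (fun p => p.coeff i) hode
  simp only [← C_ofNat (R := R) 2, coeff_add, coeff_sub, coeff_C_mul, coeff_X_mul_derivative,
      coeff_derivative, coeff_zero] at this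
  rw [← hP]
  linear_combination -this

theorem C_mul_eq_C_mul_of_recurrence {F : Type*} [Field F] {p q : F[X]} {n : ℕ} {α β : ℕ → F}
    (hp : p.natDegree ≤ n) (hq : q.natDegree ≤ n) (hβ : ∀ i < n, β i ≠ 0)
    (hpr : ∀ i < n, α i * p.coeff (i + 1) = β i * p.coeff i)
    (hqr : ∀ i < n, α i * q.coeff (i + 1) = β i * q.coeff i) :
    C (q.coeff n) * p = C (p.coeff n) * q := by
  have key : ∀ k ≤ n, q.coeff n * p.coeff (n - k) = p.coeff n * q.coeff (n - k) := by
    intro k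
    induction k with
    | zero =>
      intro _
      rw [Nat.sub_zero, mul_comm]
    | succ k ih =>
      intro hk
      have hi : n - (k + 1) < n := by omega
      have hs : n - (k + 1) + 1 = n - k := by omega
      have h1 := hpr _ hi
      have h2 := hqr _ hi
      rw [hs] at h1 h2
      apply mul_left_cancel₀ (hβ _ hi)
      linear_combination p.coeff n * h2 - q.coeff n * h1 + α (n - (k + 1)) * ih (by omega)
  ext i
  rw [coeff_C_mul, coeff_C_mul]
  by_cases hi : i ≤ n
  · have := key (n - i) (by omega)
    rwa [Nat.sub_sub_self hi] at this
  · have h1 : p.coeff i = 0 := coeff_eq_zero_of_natDegree_lt (by omega)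
    have h2 : q.coeff i = 0 := coeff_eq_zero_of_natDegree_lt (by omega)
    rw [h1, h2, mul_zero, mul_zero]

theorem choose_mul_centralBinom_succ (N i : ℕ) :
    N.choose (2 * (i + 1)) * (i + 1).centralBinom * (i + 1) ^ 2 =
      N.choose (2 * i) * i.centralBinom * ((N - 2 * i) * (N - (2 * i + 1))) := by
  have h1 := Nat.choose_succ_right_eq N (2 * i)
  have h2 := Nat.choose_succ_right_eq N (2 * i + 1)
  have h3 := Nat.succ_mul_centralBinom_succ i
  rw [show 2 * (i + 1) = 2 * i + 1 + 1 by ring]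
  calc N.choose (2 * i + 1 + 1) * (i + 1).centralBinom * (i + 1) ^ 2
      = N.choose (2 * i + 1 + 1) * (i + 1) * ((i + 1) * (i + 1).centralBinom) := by ring
    _ = (N.choose (2 * i + 1 + 1) * (2 * i + 1 + 1)) * (2 * i + 1) * i.centralBinom := by
        rw [h3]; ring
    _ = (N.choose (2 * i + 1) * (2 * i + 1)) * (N - (2 * i + 1)) * i.centralBinom := by
        rw [h2]; ring
    _ = _ := by rw [h1]; ring

theorem choose_mul_choose_add_three (m a b : ℕ) :
    m.choose (a + 1) * (a + 1).choose (b + 3) * ((b + 1) * (b + 2) * (b + 3)) =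
      m.choose a * a.choose b * ((m - a) * ((a - b) * (a - (b + 1)))) := by
  have h1 := Nat.choose_succ_right_eq m a
  have h2 := Nat.add_one_mul_choose_eq a b
  have h3 := Nat.choose_succ_right_eq (a + 1) (b + 1)
  have h4 := Nat.choose_succ_right_eq (a + 1) (b + 2)
  rw [Nat.add_sub_add_right] at h3 h4
  calc m.choose (a + 1) * (a + 1).choose (b + 3) * ((b + 1) * (b + 2) * (b + 3))
      = m.choose (a + 1) * ((a + 1).choose (b + 2 + 1) * (b + 2 + 1)) * ((b + 1) * (b + 2)) := by
        ring
    _ = m.choose (a + 1) * ((a + 1).choose (b + 1 + 1) * (b + 1 + 1)) * (b + 1) *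
          (a - (b + 1)) := by rw [h4]; ring
    _ = m.choose (a + 1) * ((a + 1).choose (b + 1) * (b + 1)) * ((a - b) * (a - (b + 1))) := by
        rw [h3]; ring
    _ = (m.choose (a + 1) * (a + 1)) * a.choose b * ((a - b) * (a - (b + 1))) := by
        rw [← h2]; ring
    _ = _ := by rw [h1]; ring

/-- The coefficients of the truncated hypergeometric polynomial attached to `J_l`. -/
def supersingularCoeff (F : Type*) [Field F] (n s i : ℕ) : F :=
  ((2 * n + s).choose (2 * i) : F) * (i.centralBinom : F) * (4⁻¹) ^ i

theorem supersingularCoeff_succ {F : Type*} [Field F] (h2 : (2 : F) ≠ 0) {n s : ℕ} (hs : s ≤ 1)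
    (i : ℕ) :
    2 * ((i : F) + 1) ^ 2 * supersingularCoeff F n s (i + 1) =
      (2 * (i : F) ^ 2 - (4 * n + 2 * s - 1) * i + n * (2 * n + 2 * s - 1)) *
        supersingularCoeff F n s i := by
  rcases lt_trichotomy i n with hi | rfl | hi
  · obtain ⟨t, rfl⟩ : ∃ t, n = i + 1 + t := ⟨n - (i + 1), by omega⟩
    have h := congrArg (Nat.cast (R := F)) (choose_mul_centralBinom_succ (2 * (i + 1 + t) + s) i)
    rw [show 2 * (i + 1 + t) + s - 2 * i = 2 * t + 2 + s by omega,
      show 2 * (i + 1 + t) + s - (2 * i + 1) = 2 * t + 1 + s by omega] at h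
    have h4 : (4 : F) ≠ 0 := by
      rw [show (4 : F) = 2 * 2 by norm_num]
      exact mul_ne_zero h2 h2
    rw [supersingularCoeff, supersingularCoeff, pow_succ]
    obtain ⟨c, hc⟩ : ∃ c : F, c = 4⁻¹ := ⟨_, rfl⟩
    have hc4 : 4 * c = 1 := by rw [hc, mul_inv_cancel₀ h4]
    rw [← hc]
    generalize (2 * (i + 1 + t) + s).choose (2 * (i + 1)) = A at h ⊢
    generalize (2 * (i + 1 + t) + s).choose (2 * i) = B at h ⊢
    push_cast at h ⊢
    interval_cases s <;> push_cast at h ⊢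
    · linear_combination 2 * c ^ i * c * h +
        (t + 1) * (2 * t + 1) * B * i.centralBinom * c ^ i * hc4
    · linear_combination 2 * c ^ i * c * h +
        (t + 1) * (2 * t + 3) * B * i.centralBinom * c ^ i * hc4
  · rw [supersingularCoeff, Nat.choose_eq_zero_of_lt (by omega)]
    push_cast
    ring
  · rw [supersingularCoeff, supersingularCoeff, Nat.choose_eq_zero_of_lt (by omega),
      Nat.choose_eq_zero_of_lt (by omega)]
    push_cast
    ring

/-- The coefficients of the Hasse invariant of `y ^ 2 = x ^ 3 + 3 * k * x + 2 * k` as a polynomial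
in `k`. -/
def hasseCoeff (F : Type*) [Field F] (n r s i : ℕ) : F :=
  ((6 * n + 2 * r + 3 * s).choose (2 * n + r + s + i) : F) *
    ((2 * n + r + s + i).choose (3 * i + r) : F) * 3 ^ (3 * i + r) * 2 ^ (2 * (n - i) + s)

theorem hasseCoeff_succ {l : ℕ} [Fact l.Prime] {n r s i : ℕ} (hr : r ≤ 1) (hs : s ≤ 1)
    (hl : l = 12 * n + 4 * r + 6 * s + 1) (hi : i < n) :
    ((i : ZMod l) + 1) * (4 * n + 2 * s - 1 - 2 * i) * hasseCoeff (ZMod l) n r s (i + 1) =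
      (2 * (i : ZMod l) ^ 2 - (4 * n + 2 * s - 1) * i + n * (2 * n + 2 * s - 1)) *
        hasseCoeff (ZMod l) n r s i := by
  obtain ⟨t, rfl⟩ : ∃ t, n = i + 1 + t := ⟨n - (i + 1), by omega⟩
  have h := congrArg (Nat.cast (R := ZMod l)) (choose_mul_choose_add_three
    (6 * (i + 1 + t) + 2 * r + 3 * s) (2 * (i + 1 + t) + r + s + i) (3 * i + r))
  rw [show 6 * (i + 1 + t) + 2 * r + 3 * s - (2 * (i + 1 + t) + r + s + i) =
      3 * i + 4 * t + 4 + r + 2 * s by omega,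
    show 2 * (i + 1 + t) + r + s + i - (3 * i + r) = 2 * t + 2 + s by omega,
    show 2 * (i + 1 + t) + r + s + i - (3 * i + r + 1) = 2 * t + 1 + s by omega] at h
  have hl0 : (12 * (i + 1 + t) + 4 * r + 6 * s + 1 : ZMod l) = 0 := by
    have := congrArg (Nat.cast (R := ZMod l)) hl
    rw [CharP.cast_eq_zero] at this
    push_cast at this
    exact this.symm
  have cast_ne : ∀ n : ℕ, 0 < n → n < l → (n : ZMod l) ≠ 0 := by
    intro n h0 hn h
    rw [ZMod.natCast_eq_zero_iff] at h
    exact absurd (Nat.le_of_dvd h0 h) (by omega)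
  have hb : (3 * i + r + 1 : ZMod l) ≠ 0 := by
    exact_mod_cast cast_ne (3 * i + r + 1) (by omega) (by omega)
  have h3 : (3 : ZMod l) ≠ 0 := by exact_mod_cast cast_ne 3 (by omega) (by omega)
  rw [hasseCoeff, hasseCoeff, show 3 * (i + 1) + r = 3 * i + r + 3 by ring,
    show 2 * (i + 1 + t) + r + s + (i + 1) = 2 * (i + 1 + t) + r + s + i + 1 by ring,
    show 2 * (i + 1 + t - (i + 1)) + s = 2 * t + s by omega,
    show 2 * (i + 1 + t - i) + s = 2 * t + s + 2 by omega, pow_add 2 _ 2, pow_add 3 _ 3]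
  generalize ((6 * (i + 1 + t) + 2 * r + 3 * s).choose (2 * (i + 1 + t) + r + s + i + 1)) = A at h ⊢
  generalize ((6 * (i + 1 + t) + 2 * r + 3 * s).choose (2 * (i + 1 + t) + r + s + i)) = B at h ⊢
  generalize (2 * (i + 1 + t) + r + s + i + 1).choose (3 * i + r + 3) = A' at h ⊢
  generalize (2 * (i + 1 + t) + r + s + i).choose (3 * i + r) = B' at h ⊢
  generalize (3 : ZMod l) ^ (3 * i + r) = u
  generalize (2 : ZMod l) ^ (2 * t + s) = v
  push_cast at h ⊢
  have h' : 3 * (A * A' * ((3 * i + r + 2) * (3 * i + r + 3))) +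
      B * B' * ((2 * t + 2 + s) * (2 * t + 1 + s)) = (0 : ZMod l) := by
    apply (mul_eq_zero.1 _).resolve_left hb
    linear_combination 3 * h + B * B' * ((2 * t + 2 + s) * (2 * t + 1 + s)) * hl0
  apply mul_left_cancel₀ h3
  interval_cases r <;> interval_cases s <;> push_cast at h' hl0 ⊢
  · linear_combination -6 * u * v * h' + 27 * (i + 1) * A * A' * u * v * hl0
  · linear_combination -6 * u * v * h' + 27 * (i + 1) * A * A' * u * v * hl0
  · linear_combination -6 * u * v * h' + 27 * (i + 1) * A * A' * u * v * hl0
  · linear_combination -6 * u * v * h' + 27 * (i + 1) * A * A' * u * v * hl0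

theorem sum_hasseCoeff_eq_zero {l : ℕ} [Fact l.Prime] {n r s : ℕ} (hr : r ≤ 1) (hs : s ≤ 1)
    (hl : l = 12 * n + 4 * r + 6 * s + 1) (hl3 : 3 < l) {k : ZMod l}
    (h : ∑ i ∈ Finset.range (n + 1), supersingularCoeff (ZMod l) n s i * (k + 1) ^ i = 0) :
    ∑ i ∈ Finset.range (n + 1), hasseCoeff (ZMod l) n r s i * k ^ i = 0 := by
  have hprime : l.Prime := Fact.out
  have cast_ne : ∀ n : ℕ, 0 < n → n < l → (n : ZMod l) ≠ 0 := by
    intro n h0 hn h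
    rw [ZMod.natCast_eq_zero_iff] at h
    exact absurd (Nat.le_of_dvd h0 h) (by omega)
  have h2 : (2 : ZMod l) ≠ 0 := by exact_mod_cast cast_ne 2 (by omega) (by omega)
  have hcoeff : ∀ (f : ℕ → ZMod l) (i : ℕ),
      (∑ i ∈ Finset.range (n + 1), C (f i) * X ^ i).coeff i = if i ≤ n then f i else 0 := by
    intro f i
    simp [coeff_C_mul, coeff_X_pow]
  have hdeg : ∀ f : ℕ → ZMod l,
      (∑ i ∈ Finset.range (n + 1), C (f i) * X ^ i).natDegree ≤ n := by
    intro f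
    rw [natDegree_le_iff_coeff_eq_zero]
    intro i hi
    rw [hcoeff, if_neg (by omega)]
  have heval : ∀ (f : ℕ → ZMod l) (x : ZMod l),
      (∑ i ∈ Finset.range (n + 1), C (f i) * X ^ i).eval x =
        ∑ i ∈ Finset.range (n + 1), f i * x ^ i := by
    intro f x
    simp [eval_finsetSum]
  rw [← heval] at h ⊢
  obtain ⟨G, hG⟩ : ∃ G, G =
      ∑ i ∈ Finset.range (n + 1), C (supersingularCoeff (ZMod l) n s i) * X ^ i := ⟨_, rfl⟩
  obtain ⟨H, hH⟩ : ∃ H, H =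
      ∑ i ∈ Finset.range (n + 1), C (hasseCoeff (ZMod l) n r s i) * X ^ i := ⟨_, rfl⟩
  rw [← hG] at h
  rw [← hH]
  have hGc : ∀ i, G.coeff i = supersingularCoeff (ZMod l) n s i := by
    intro i
    rw [hG, hcoeff]
    split_ifs with hi
    · rfl
    · rw [supersingularCoeff, Nat.choose_eq_zero_of_lt (by omega)]
      simp
  have hGn : G.coeff n ≠ 0 := by
    have hchoose : ∀ a b, b ≤ a → a < l → ((a.choose b : ℕ) : ZMod l) ≠ 0 := by
      intro a b hb ha h0
      rw [ZMod.natCast_eq_zero_iff] at h0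
      exact absurd ((hprime.dvd_factorial).1
        (h0.trans (Dvd.intro _ ((mul_assoc _ _ _).symm.trans
          (Nat.choose_mul_factorial_mul_factorial hb))))) (by omega)
    have h4 : (4 : ZMod l) ≠ 0 := by
      rw [show (4 : ZMod l) = 2 * 2 by norm_num]
      exact mul_ne_zero h2 h2
    rw [hGc, supersingularCoeff, Nat.centralBinom]
    exact mul_ne_zero (mul_ne_zero (hchoose _ _ (by omega) (by omega))
      (hchoose _ _ (by omega) (by omega))) (pow_ne_zero _ (inv_ne_zero h4))
  have hGdeg : G.natDegree = n :=
    natDegree_eq_of_le_of_coeff_ne_zero (hG ▸ hdeg _) hGn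
  have hPn : (taylor 1 G).coeff n = G.coeff n := by
    have := coeff_taylor_natDegree (f := G) (r := 1)
    rwa [leadingCoeff, hGdeg] at this
  have key := C_mul_eq_C_mul_of_recurrence (p := taylor 1 G) (q := H) (n := n)
    (α := fun i => ((i : ZMod l) + 1) * (4 * n + 2 * s - 1 - 2 * i))
    (β := fun i => 2 * (i : ZMod l) ^ 2 - (4 * n + 2 * s - 1) * i + n * (2 * n + 2 * s - 1))
    (by rw [natDegree_taylor, hGdeg]) (hH ▸ hdeg _)
    (by
      intro i hi
      obtain ⟨t, rfl⟩ : ∃ t, n = i + 1 + t := ⟨n - (i + 1), by omega⟩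
      have := mul_ne_zero (cast_ne (t + 1) (by omega) (by omega))
        (cast_ne (2 * t + 1 + 2 * s) (by omega) (by omega))
      convert this using 1
      push_cast
      ring)
    (fun i _ => taylor_one_coeff_recurrence (fun i => by
      rw [hGc, hGc]
      exact supersingularCoeff_succ h2 hs i) i)
    (fun i hi => by
      rw [hH, hcoeff, hcoeff, if_pos (by omega), if_pos (by omega)]
      exact hasseCoeff_succ hr hs hl hi)
  have := congrArg (eval k) key
  rw [eval_mul, eval_mul, eval_C, eval_C, taylor_eval, h, mul_zero, hPn] at this
  exact (mul_eq_zero.1 this.symm).resolve_left hGn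

theorem sum_pow_eq_ite {l : ℕ} [Fact l.Prime] {m N : ℕ} (hl : l = 2 * m + 1) (hN : N ≤ 3 * m) :
    ∑ x : ZMod l, x ^ N = if N = 2 * m then -1 else 0 := by
  have hprime : l.Prime := Fact.out
  have hm : 0 < m := by
    rcases Nat.eq_zero_or_pos m with rfl | h
    · exact absurd hprime (by rw [hl]; norm_num)
    · exact h
  have hlt : ∀ N < 2 * m, ∑ x : ZMod l, x ^ N = 0 := by
    intro N hN
    apply FiniteField.sum_pow_lt_card_sub_one
    rw [ZMod.card]
    omega
  rcases lt_trichotomy N (2 * m) with h | rfl | h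
  · rw [if_neg h.ne, hlt N h]
  · rw [if_pos rfl]
    have hx : ∀ x : ZMod l, x ^ (2 * m) = 1 - if x = 0 then 1 else 0 := by
      intro x
      split_ifs with h0
      · rw [h0, zero_pow (by omega), sub_self]
      · rw [sub_zero, ← ZMod.pow_card_sub_one_eq_one h0]
        congr 1
        omega
    simp [hx]
  · rw [if_neg h.ne', ← hlt (N - 2 * m) (by omega)]
    refine Finset.sum_congr rfl fun x _ => ?_
    obtain ⟨t, rfl⟩ : ∃ t, N = t + 1 + 2 * m := ⟨N - 2 * m - 1, by omega⟩
    have hxl : x ^ (2 * m) * x = x := by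
      rw [← pow_succ, ← hl, ZMod.pow_card]
    rw [Nat.add_sub_cancel, pow_add, pow_succ, mul_assoc, mul_comm x, hxl]

theorem sum_cubic_pow_half {l : ℕ} [Fact l.Prime] {n r s : ℕ} (hr : r ≤ 1) (hs : s ≤ 1)
    (hl : l = 12 * n + 4 * r + 6 * s + 1) (k : ZMod l) :
    ∑ x : ZMod l, (x ^ 3 + 3 * k * x + 2 * k) ^ (6 * n + 2 * r + 3 * s) =
      -k ^ (2 * n + r + s) * ∑ i ∈ Finset.range (n + 1), hasseCoeff (ZMod l) n r s i * k ^ i := by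
  obtain ⟨m, hm⟩ : ∃ m, m = 6 * n + 2 * r + 3 * s := ⟨_, rfl⟩
  have hlm : l = 2 * m + 1 := by omega
  rw [← hm]
  have hexp : ∀ x : ZMod l, (x ^ 3 + 3 * k * x + 2 * k) ^ m =
      ∑ a ∈ Finset.range (m + 1), ∑ b ∈ Finset.range (a + 1),
        (k ^ a * m.choose a * a.choose b * 3 ^ b * 2 ^ (a - b)) * x ^ (3 * (m - a) + b) := by
    intro x
    rw [show x ^ 3 + 3 * k * x + 2 * k = k * (3 * x + 2) + x ^ 3 by ring, add_pow]
    refine Finset.sum_congr rfl fun a _ => ?_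
    rw [mul_pow, add_pow, Finset.mul_sum, Finset.sum_mul, Finset.sum_mul]
    refine Finset.sum_congr rfl fun b _ => ?_
    rw [pow_add, pow_mul, mul_pow]
    ring
  have hsum : ∑ x : ZMod l, (x ^ 3 + 3 * k * x + 2 * k) ^ m =
      ∑ a ∈ Finset.range (m + 1), ∑ b ∈ Finset.range (a + 1),
        (k ^ a * m.choose a * a.choose b * 3 ^ b * 2 ^ (a - b)) *
          if 3 * (m - a) + b = 2 * m then -1 else 0 := by
    simp_rw [hexp]
    rw [Finset.sum_comm]
    refine Finset.sum_congr rfl fun a ha => ?_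
    rw [Finset.sum_comm]
    refine Finset.sum_congr rfl fun b hb => ?_
    rw [Finset.mem_range] at ha hb
    rw [← Finset.mul_sum, sum_pow_eq_ite hlm (by omega)]
  rw [hsum, Finset.mul_sum]
  symm
  refine Finset.sum_of_injOn (fun i => 2 * n + r + s + i) ?_ ?_ ?_ ?_
  · intro i _ j _ hij
    exact Nat.add_left_cancel hij
  · intro i hi
    simp only [Finset.coe_range, Set.mem_Iio] at hi ⊢
    omega
  · intro a ha hna
    rw [Finset.mem_range] at ha
    refine Finset.sum_eq_zero fun b hb => ?_
    rw [Finset.mem_range] at hb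
    rw [if_neg, mul_zero]
    intro hab
    apply hna
    refine ⟨a - (2 * n + r + s), ?_, ?_⟩
    · simp only [Finset.coe_range, Set.mem_Iio]
      omega
    · show 2 * n + r + s + (a - (2 * n + r + s)) = a
      omega
  · intro i hi
    rw [Finset.mem_range] at hi
    rw [Finset.sum_eq_single_of_mem (3 * i + r) (by rw [Finset.mem_range]; omega)]
    · rw [if_pos (by omega), hasseCoeff, hm,
        show 2 * n + r + s + i - (3 * i + r) = 2 * (n - i) + s by omega]
      ring
    · intro b hb hne
      rw [Finset.mem_range] at hb
      rw [if_neg (by omega), mul_zero]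

theorem eval_Jpoly_mul_pow {l : ℕ} [Fact l.Prime] (hl : l ≠ 2) {n s : ℕ} (hn : n = l / 12)
    (hs : s = if l % 4 = 3 then 1 else 0) {j u : ZMod l} (h : (j - 1728) * u = -1728) :
    (Jpoly l).eval j * u ^ n =
      (-1728) ^ n * ∑ i ∈ Finset.range (n + 1), supersingularCoeff (ZMod l) n s i * u ^ i := by
  have hprime : l.Prime := Fact.out
  have h4 : (4 : ZMod l) ≠ 0 := by
    have h2 : ((2 : ℕ) : ZMod l) ≠ 0 := by
      intro h0
      rw [ZMod.natCast_eq_zero_iff, Nat.prime_dvd_prime_iff_eq hprime Nat.prime_two] at h0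
      exact hl h0
    rw [show (4 : ZMod l) = (2 : ℕ) * (2 : ℕ) by norm_num]
    exact mul_ne_zero h2 h2
  rw [Jpoly, ← hn, ← hs, ← Finset.sum_range_reflect, eval_finsetSum, Finset.sum_mul,
    Finset.mul_sum]
  refine Finset.sum_congr rfl fun i hi => ?_
  rw [Finset.mem_range] at hi
  obtain ⟨t, rfl⟩ : ∃ t, n = i + t := ⟨n - i, by omega⟩
  rw [show i + t + 1 - 1 - i = t by omega, show i + t - t = i by omega,
    show 2 * (i + t) - 2 * t = 2 * i by omega, supersingularCoeff, Nat.centralBinom,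
    ← Nat.choose_symm (n := 2 * (i + t) + s) (k := 2 * i) (by omega),
    show 2 * (i + t) + s - 2 * i = 2 * t + s by omega]
  have h432 : (-432 : ZMod l) = -1728 * 4⁻¹ := by
    field_simp
    norm_num
  have ht : (j - 1728) ^ t * u ^ t = (-1728) ^ t := by rw [← mul_pow, h]
  simp only [eval_mul, eval_pow, eval_sub, eval_X, eval_natCast, eval_neg, eval_ofNat]
  rw [h432, pow_add u, pow_add (-1728 : ZMod l) i, mul_pow, ← ht]
  ring

/-- If `l ≡ 4 (mod 5)` is prime and `j ∈ 𝔽_l`, `j ≠ 0, 1728`, is a supersingular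
`j`-invariant (a root of `J_l`), then
`f_j(x) = (x⁴+12x³+14x²-12x+1)³ - j·x⁵(1-11x-x²)` has exactly 4 distinct roots in `𝔽_l`. -/
theorem four_roots_of_fj (l : ℕ) [Fact l.Prime] (hl5 : l % 5 = 4)
    (j : ZMod l) (hj0 : j ≠ 0) (hj1728 : j ≠ 1728) (hss : (Jpoly l).eval j = 0) :
    (((X ^ 4 + 12 * X ^ 3 + 14 * X ^ 2 - 12 * X + 1) ^ 3 -
        C j * (X ^ 5 * (1 - 11 * X - X ^ 2)) : Polynomial (ZMod l))).roots.toFinset.card = 4 := by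
  have hprime : l.Prime := Fact.out
  have hl12 : 3 < l ∧ l % 2 = 1 ∧ l % 3 ≠ 0 := by
    have hl2 : l ≠ 2 := by omega
    have hl3 : l ≠ 3 := by omega
    have h2 := hprime.eq_two_or_odd
    have h3 : ¬ 3 ∣ l := fun h =>
      hl3 ((Nat.prime_dvd_prime_iff_eq Nat.prime_three hprime).1 h).symm
    omega
  obtain ⟨hl3, hodd, hmod3⟩ := hl12
  obtain ⟨n, hn⟩ : ∃ n, n = l / 12 := ⟨_, rfl⟩
  obtain ⟨s, hs⟩ : ∃ s, s = if l % 4 = 3 then 1 else 0 := ⟨_, rfl⟩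
  obtain ⟨r, hr⟩ : ∃ r, r = if l % 3 = 2 then 1 else 0 := ⟨_, rfl⟩
  have hl : l = 12 * n + 4 * r + 6 * s + 1 := by
    split_ifs at hs hr <;> omega
  have hr1 : r ≤ 1 := by split_ifs at hr <;> omega
  have hs1 : s ≤ 1 := by split_ifs at hs <;> omega
  have h2 : (2 : ZMod l) ≠ 0 := by
    intro h
    have h' : ((2 : ℕ) : ZMod l) = 0 := by exact_mod_cast h
    rw [ZMod.natCast_eq_zero_iff] at h'
    exact absurd (Nat.le_of_dvd two_pos h') (by omega)
  have h3 : (3 : ZMod l) ≠ 0 := by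
    intro h
    have h' : ((3 : ℕ) : ZMod l) = 0 := by exact_mod_cast h
    rw [ZMod.natCast_eq_zero_iff] at h'
    exact absurd (Nat.le_of_dvd three_pos h') (by omega)
  have h108 : (108 : ZMod l) ≠ 0 := by
    rw [show (108 : ZMod l) = 2 ^ 2 * 3 ^ 3 by norm_num]
    exact mul_ne_zero (pow_ne_zero _ h2) (pow_ne_zero _ h3)
  have h1728 : (1728 : ZMod l) ≠ 0 := by
    rw [show (1728 : ZMod l) = 2 ^ 6 * 3 ^ 3 by norm_num]
    exact mul_ne_zero (pow_ne_zero _ h2) (pow_ne_zero _ h3)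
  have hsub : 1728 - j ≠ 0 := sub_ne_zero.2 hj1728.symm
  obtain ⟨k, hk⟩ : ∃ k, k = j / (1728 - j) := ⟨_, rfl⟩
  have hk' : k * (1728 - j) = j := by rw [hk, div_mul_cancel₀ _ hsub]
  have hk0 : k ≠ 0 := by rw [hk]; exact div_ne_zero hj0 hsub
  have hk1 : k + 1 ≠ 0 := by
    intro h
    exact h1728 (by linear_combination (1728 - j) * h - hk')
  have hG : ∑ i ∈ Finset.range (n + 1), supersingularCoeff (ZMod l) n s i * (k + 1) ^ i = 0 := by
    have h := eval_Jpoly_mul_pow (by omega) hn hs (j := j) (u := k + 1)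
      (by linear_combination -hk')
    rw [hss, zero_mul] at h
    exact (mul_eq_zero.1 h.symm).resolve_left (pow_ne_zero _ (neg_ne_zero.2 h1728))
  have hcubic := sum_cubic_pow_half hr1 hs1 hl k
  rw [sum_hasseCoeff_eq_zero hr1 hs1 hl hl3 hG, mul_zero,
    show 6 * n + 2 * r + 3 * s = l / 2 by omega] at hcubic
  obtain ⟨x, hx⟩ := exists_root_of_sum_quadraticChar_eq_zero (F := ZMod l) (a := 3 * k)
    (b := 2 * k) (j := j) h2 h3 (by rw [ZMod.card]; omega)
    (by
      rw [show 4 * (3 * k) ^ 3 + 27 * (2 * k) ^ 2 = 108 * k ^ 2 * (k + 1) by ring]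
      exact mul_ne_zero (mul_ne_zero h108 (pow_ne_zero _ hk0)) hk1)
    (by linear_combination (-108 * k ^ 2) * hk')
    (sum_quadraticChar_eq_zero hl3 _ _ hcubic)
  exact card_roots_eq_four_of_root hl5 (by omega) hj0 hj1728 hx
end

section
/- Let l be a prime with l ≡ 4 (mod 5) for which (−3|l) = −1 (so that j = 0 is a supersingular j-invariant in characteristic l). Then f₀(x) = x⁴ + 12x³ + 14x² − 12x + 1 splits into distinct linear factors over 𝔽_l, i.e., f₀ has 4 distinct roots in 𝔽_l. -/
open Polynomial

/-- In a finite field, the product of two nonsquares is a square. -/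
theorem isSquare_mul_of_not_isSquare {F : Type*} [Field F] [Fintype F] [DecidableEq F] {a b : F}
    (ha : ¬IsSquare a) (hb : ¬IsSquare b) : IsSquare (a * b) := by
  have hab : a * b ≠ 0 := by
    apply mul_ne_zero
    · rintro rfl
      exact ha IsSquare.zero
    · rintro rfl
      exact hb IsSquare.zero
  rw [← quadraticChar_one_iff_isSquare hab, map_mul,
    quadraticChar_neg_one_iff_not_isSquare.mpr ha, quadraticChar_neg_one_iff_not_isSquare.mpr hb]
  norm_num

theorem ZMod.isSquare_five {l : ℕ} [Fact l.Prime] (hl5 : l % 5 = 4) :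
    IsSquare (5 : ZMod l) := by
  have : Fact (Nat.Prime 5) := ⟨by norm_num⟩
  have h2 : l ≠ 2 := by rintro rfl; omega
  have h := (ZMod.exists_sq_eq_prime_iff_of_mod_four_eq_one (p := 5) (q := l) (by norm_num) h2).1
  have h4 : (l : ZMod 5) = 4 := by
    rw [← ZMod.natCast_mod, hl5]
    rfl
  exact_mod_cast h (by rw [h4]; exact ⟨2, rfl⟩)

theorem ZMod.five_ne_zero {l : ℕ} [Fact l.Prime] (hl5 : l % 5 = 4) : (5 : ZMod l) ≠ 0 := by
  intro h
  have h' : ((5 : ℕ) : ZMod l) = 0 := by exact_mod_cast h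
  rw [ZMod.natCast_eq_zero_iff] at h'
  have := (Nat.prime_dvd_prime_iff_eq (Fact.out : l.Prime) (by norm_num)).1 h'
  omega

theorem ZMod.two_ne_zero_of_mod_five {l : ℕ} [Fact l.Prime] (hl5 : l % 5 = 4) :
    (2 : ZMod l) ≠ 0 := by
  intro h
  have h' : ((2 : ℕ) : ZMod l) = 0 := by exact_mod_cast h
  rw [ZMod.natCast_eq_zero_iff] at h'
  have := (Nat.prime_dvd_prime_iff_eq (Fact.out : l.Prime) (by norm_num)).1 h'
  omega

/-- If `t = ζ + ζ⁻¹` for a primitive fifth root of unity `ζ`, the discriminant `t ^ 2 - 4` of the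
minimal polynomial of `ζ` is not a square in `𝔽_l`, since `𝔽_l` contains no such `ζ`. -/
theorem ZMod.not_isSquare_sq_sub_four {l : ℕ} [Fact l.Prime] (hl5 : l % 5 = 4) {t : ZMod l}
    (ht : t ^ 2 + t - 1 = 0) : ¬IsSquare (t ^ 2 - 4) := by
  rintro ⟨u, hu⟩
  have h2 := ZMod.two_ne_zero_of_mod_five hl5
  have : Fact (Nat.Prime 5) := ⟨by norm_num⟩
  obtain ⟨z, hz⟩ : ∃ z, z ^ 2 - t * z + 1 = 0 :=
    ⟨(t + u) / 2, by field_simp; linear_combination -hu⟩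
  have hz0 : z ≠ 0 := by
    rintro rfl
    simp at hz
  have hz5 : z ^ 5 = 1 := by
    have h : z ^ 4 + z ^ 3 + z ^ 2 + z + 1 = 0 := by
      linear_combination (z ^ 2 + (1 + t) * z + 1) * hz + z ^ 2 * ht
    linear_combination (z - 1) * h
  have hz1 : z ≠ 1 := by
    rintro rfl
    exact ZMod.five_ne_zero hl5 (by linear_combination ht + (t + 3) * hz)
  have hd := ZMod.orderOf_dvd_card_sub_one hz0
  rw [orderOf_eq_prime hz5 hz1] at hd
  omega

theorem ZMod.not_isSquare_neg_five_add_two_mul {l : ℕ} [Fact l.Prime] (hl5 : l % 5 = 4)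
    {s : ZMod l} (hs : s ^ 2 = 5) : ¬IsSquare (-(5 + 2 * s)) := by
  rintro ⟨u, hu⟩
  have h2 := ZMod.two_ne_zero_of_mod_five hl5
  refine ZMod.not_isSquare_sq_sub_four hl5 (t := (s - 1) / 2) ?_ ⟨u * ((s - 1) / 2), ?_⟩
  · field_simp
    linear_combination hs
  · field_simp
    linear_combination (s - 1) ^ 2 * hu + (2 * s + 2) * hs

/-- If `l ≡ 4 (mod 5)` is a prime with `(-3|l) = -1` (so `j = 0` is supersingular in
characteristic `l`), then `f₀(x) = x⁴+12x³+14x²-12x+1` splits into distinct linear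
factors over `𝔽_l`, i.e. it has 4 distinct roots in `𝔽_l`. -/
theorem f0_four_roots (l : ℕ) [Fact l.Prime] (hl5 : l % 5 = 4)
    (h3 : legendreSym l (-3) = -1) :
    ((X ^ 4 + 12 * X ^ 3 + 14 * X ^ 2 - 12 * X + 1 :
        Polynomial (ZMod l))).roots.toFinset.card = 4 := by
  have h2 := ZMod.two_ne_zero_of_mod_five hl5
  have h5 := ZMod.five_ne_zero hl5
  have hns : ¬IsSquare (-3 : ZMod l) := by
    have := (legendreSym.eq_neg_one_iff l).1 h3
    exact_mod_cast this
  obtain ⟨s, hs⟩ := ZMod.isSquare_five hl5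
  have hs2 : s ^ 2 = 5 := by rw [hs, sq]
  have hs0 : s ≠ 0 := by
    rintro rfl
    exact h5 (by simpa using hs)
  have sqrt_exists : ∀ r : ZMod l, r ^ 2 = 5 → ∃ a, a ≠ 0 ∧ a ^ 2 = 3 * (5 + 2 * r) := by
    intro r hr
    have hr' := ZMod.not_isSquare_neg_five_add_two_mul hl5 hr
    obtain ⟨a, ha⟩ := isSquare_mul_of_not_isSquare hns hr'
    refine ⟨a, ?_, by linear_combination -ha⟩
    rintro rfl
    rw [mul_zero, mul_eq_zero] at ha
    rcases ha with h | h
    · exact hns (h ▸ IsSquare.zero)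
    · exact hr' (h ▸ IsSquare.zero)
  obtain ⟨a, ha0, ha⟩ := sqrt_exists s hs2
  obtain ⟨b, hb0, hb⟩ := sqrt_exists (-s) (by rw [neg_sq, hs2])
  have hsC : (C s : (ZMod l)[X]) ^ 2 = 5 := by rw [← C_pow, hs2]; rfl
  have haC : (C a : (ZMod l)[X]) ^ 2 = 3 * (5 + 2 * C s) := by
    rw [← C_pow, ha]
    simp only [C_mul, C_add, map_ofNat]
  have hbC : (C b : (ZMod l)[X]) ^ 2 = 3 * (5 - 2 * C s) := by
    rw [← C_pow, hb]
    simp only [C_mul, C_add, C_neg, map_ofNat]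
    ring
  have hfac : (X ^ 4 + 12 * X ^ 3 + 14 * X ^ 2 - 12 * X + 1 : (ZMod l)[X]) =
      (({-3 - s + a, -3 - s - a, -3 + s + b, -3 + s - b} : Multiset (ZMod l)).map
        fun r => X - C r).prod := by
    have e₁ : (X - C (-3 - s + a)) * (X - C (-3 - s - a)) =
        (X ^ 2 + (6 + 2 * C s) * X - 1 : (ZMod l)[X]) := by
      simp only [C_add, C_sub, C_neg, map_ofNat]
      linear_combination hsC - haC
    have e₂ : (X - C (-3 + s + b)) * (X - C (-3 + s - b)) =
        (X ^ 2 + (6 - 2 * C s) * X - 1 : (ZMod l)[X]) := by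
      simp only [C_add, C_sub, C_neg, map_ofNat]
      linear_combination hsC - hbC
    simp only [Multiset.insert_eq_cons, Multiset.map_cons, Multiset.prod_cons,
      Multiset.map_singleton, Multiset.prod_singleton]
    rw [← mul_assoc, e₁, e₂]
    linear_combination 4 * X ^ 2 * hsC
  have no_common_root : ∀ x y : ZMod l, x ^ 2 + (6 + 2 * s) * x - 1 = 0 →
      y ^ 2 + (6 - 2 * s) * y - 1 = 0 → x ≠ y := by
    rintro x _ hx hy rfl
    have h : 2 * 2 * s * x = 0 := by linear_combination hx - hy
    have hx0 : x = 0 := by simpa [h2, hs0] using h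
    simp [hx0] at hx
  have self_ne : ∀ c d : ZMod l, d ≠ 0 → c + d ≠ c - d := by
    intro c d hd h
    exact mul_ne_zero h2 hd (by linear_combination h)
  have ra₁ : (-3 - s + a) ^ 2 + (6 + 2 * s) * (-3 - s + a) - 1 = 0 := by
    linear_combination ha - hs2
  have ra₂ : (-3 - s - a) ^ 2 + (6 + 2 * s) * (-3 - s - a) - 1 = 0 := by
    linear_combination ha - hs2
  have rb₁ : (-3 + s + b) ^ 2 + (6 - 2 * s) * (-3 + s + b) - 1 = 0 := by
    linear_combination hb - hs2
  have rb₂ : (-3 + s - b) ^ 2 + (6 - 2 * s) * (-3 + s - b) - 1 = 0 := by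
    linear_combination hb - hs2
  rw [hfac, roots_multiset_prod_X_sub_C, Multiset.toFinset_card_of_nodup]
  · rfl
  · simp only [Multiset.insert_eq_cons, Multiset.nodup_cons, Multiset.mem_cons,
      Multiset.mem_singleton, Multiset.nodup_singleton, not_or, and_true]
    exact ⟨⟨self_ne _ _ ha0, no_common_root _ _ ra₁ rb₁, no_common_root _ _ ra₁ rb₂⟩,
      ⟨no_common_root _ _ ra₂ rb₁, no_common_root _ _ ra₂ rb₂⟩, self_ne _ _ hb0⟩
end

section
/- Let l be a prime with l ≡ 1 (mod 5) for which (−3|l) = −1. Then over 𝔽_l the polynomial f₀(x) = x⁴ + 12x³ + 14x² − 12x + 1 splits into a product of two distinct irreducible quadratics of the form x² + ax − 1: there exist a₁ ≠ a₂ in 𝔽_l such that f₀(x) = (x² + a₁x − 1)(x² + a₂x − 1) in 𝔽_l[x], with both factors irreducible over 𝔽_l. -/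
open Polynomial

/-- A prime `l ≡ 1 (mod 5)` admits a root of the fifth cyclotomic polynomial in `𝔽_l`. -/
theorem exists_fifth_cyclotomic_root (l : ℕ) [Fact l.Prime] (hl5 : l % 5 = 1) :
    ∃ z : ZMod l, z ^ 4 + z ^ 3 + z ^ 2 + z + 1 = 0 := by
  have : Fact (Nat.Prime 5) := ⟨by norm_num⟩
  obtain ⟨u, hu⟩ := exists_prime_orderOf_dvd_card (G := (ZMod l)ˣ) 5 (by
    rw [ZMod.card_units]; omega)
  have h5 : (u : ZMod l) ^ 5 = 1 := by
    rw [← Units.val_pow_eq_pow_val, ← hu, pow_orderOf_eq_one, Units.val_one]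
  have h1 : (u : ZMod l) - 1 ≠ 0 := by
    rw [sub_ne_zero]
    intro h
    rw [Units.val_eq_one.mp h, orderOf_one] at hu
    omega
  refine ⟨u, (mul_eq_zero.mp ?_).resolve_left h1⟩
  linear_combination h5

/-- Over a field where `-3` is not a square, `x² + ax - 1` is irreducible if its discriminant
`a² + 4` is `-12 t²` with `t ≠ 0`. -/
theorem irreducible_X_sq_add_C_mul_X_sub_one {K : Type*} [Field K] (h2 : (2 : K) ≠ 0)
    (h3 : ¬ IsSquare (-3 : K)) {a t : K} (ht : t ≠ 0) (h : a ^ 2 + 4 = -12 * t ^ 2) :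
    Irreducible (X ^ 2 + C a * X - 1 : K[X]) := by
  have hdeg : (X ^ 2 + C a * X - 1 : K[X]).natDegree = 2 := by compute_degree!
  rw [irreducible_iff_roots_eq_zero_of_degree_le_three (by omega) (by omega)]
  refine Multiset.eq_zero_of_forall_notMem fun x hx => h3 ⟨(2 * x + a) / (2 * t), ?_⟩
  have hx' := isRoot_of_mem_roots hx
  simp only [IsRoot.def, eval_sub, eval_add, eval_pow, eval_X, eval_mul, eval_C, eval_one] at hx'
  field_simp
  linear_combination -4 * hx' - h

/-- If `l ≡ 1 (mod 5)` is a prime with `(-3|l) = -1`, then over `𝔽_l` the polynomial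
`f₀(x) = x⁴+12x³+14x²-12x+1` splits into a product of two distinct irreducible
quadratics of the form `x² + ax - 1`. -/
theorem f0_splits_two_quadratics (l : ℕ) [Fact l.Prime] (hl5 : l % 5 = 1)
    (h3 : legendreSym l (-3) = -1) :
    ∃ a₁ a₂ : ZMod l, a₁ ≠ a₂ ∧
      (X ^ 4 + 12 * X ^ 3 + 14 * X ^ 2 - 12 * X + 1 : Polynomial (ZMod l)) =
        (X ^ 2 + C a₁ * X - 1) * (X ^ 2 + C a₂ * X - 1) ∧
      Irreducible (X ^ 2 + C a₁ * X - 1 : Polynomial (ZMod l)) ∧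
      Irreducible (X ^ 2 + C a₂ * X - 1 : Polynomial (ZMod l)) := by
  have hns : ¬ IsSquare (-3 : ZMod l) := by
    have := (legendreSym.eq_neg_one_iff l).mp h3
    push_cast at this
    exact this
  have hne (p : ℕ) (hp : p.Prime) (hpl : p % 5 ≠ 1) : (p : ZMod l) ≠ 0 := by
    rw [Ne, ZMod.natCast_eq_zero_iff, Nat.prime_dvd_prime_iff_eq Fact.out hp]
    rintro rfl
    exact hpl hl5
  have h2 : (2 : ZMod l) ≠ 0 := by exact_mod_cast hne 2 (by norm_num) (by norm_num)
  have h5 : (5 : ZMod l) ≠ 0 := by exact_mod_cast hne 5 (by norm_num) (by norm_num)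
  obtain ⟨z, hz⟩ := exists_fifth_cyclotomic_root l hl5
  have hz4 : z ^ 4 = -(z ^ 3 + z ^ 2 + z + 1) := by linear_combination hz
  have hz5 : z ^ 5 = 1 := by linear_combination (z - 1) * hz
  obtain ⟨s, hs⟩ : ∃ s, s = 1 + 2 * (z + z ^ 4) := ⟨_, rfl⟩
  have hs2 : s ^ 2 = 5 := by
    rw [hs]
    linear_combination 8 * hz5 + 4 * z ^ 3 * hz5 + 4 * hz
  have hs0 : s ≠ 0 := by
    rintro rfl
    exact h5 (by linear_combination -hs2)
  obtain ⟨t₁, ht₁⟩ : ∃ t, t ^ 2 = -(5 + 2 * s) := by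
    refine ⟨(z - z ^ 4) * (z + z ^ 4 + 1), ?_⟩
    rw [hs, hz4]
    grind
  obtain ⟨t₂, ht₂⟩ : ∃ t, t ^ 2 = -(5 - 2 * s) := by
    refine ⟨(z ^ 2 - z ^ 3) * (z ^ 2 + z ^ 3 + 1), ?_⟩
    rw [hs, hz4]
    grind
  have hprod : (5 + 2 * s) * (5 - 2 * s) = 5 := by linear_combination -4 * hs2
  refine ⟨6 + 2 * s, 6 - 2 * s, ?_, ?_, ?_, ?_⟩
  · intro h
    exact mul_ne_zero (mul_ne_zero h2 h2) hs0 (by linear_combination h)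
  · have hC : (C s) ^ 2 = (5 : (ZMod l)[X]) := by rw [← C_pow, hs2]; rfl
    simp only [C_add, C_sub, C_mul, C_ofNat]
    linear_combination 4 * X ^ 2 * hC
  · refine irreducible_X_sq_add_C_mul_X_sub_one h2 hns (t := t₁) (fun h => h5 ?_)
      (by linear_combination 4 * hs2 + 12 * ht₁)
    rw [h] at ht₁
    linear_combination -hprod + (5 - 2 * s) * ht₁
  · refine irreducible_X_sq_add_C_mul_X_sub_one h2 hns (t := t₂) (fun h => h5 ?_)
      (by linear_combination 4 * hs2 + 12 * ht₂)
    rw [h] at ht₂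
    linear_combination -hprod + (5 + 2 * s) * ht₂
end

section
/- The splitting field of f₀(x) = x⁴ + 12x³ + 14x² − 12x + 1 over ℚ and the splitting field of g₀(x) = x⁴ − 228x³ + 494x² + 228x + 1 over ℚ are both equal to ℚ(ζ₁₅ + ζ₁₅⁻¹), the maximal real subfield of the 15th cyclotomic field. -/
open Polynomial

/-- An extension generated by the roots of `f` is `ℚ(t)` as soon as every root lies in `ℚ(t)`
and `t` lies in the field generated by one of the roots. -/
lemma adjoin_rootSet_eq_adjoin_singleton {f : ℚ[X]} {t r : ℂ}
    (hroots : ∀ z ∈ f.rootSet ℂ, z ∈ IntermediateField.adjoin ℚ {t})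
    (hr : r ∈ f.rootSet ℂ) (ht : t ∈ IntermediateField.adjoin ℚ {r}) :
    IntermediateField.adjoin ℚ (f.rootSet ℂ) = IntermediateField.adjoin ℚ {t} := by
  apply le_antisymm
  · exact IntermediateField.adjoin_le_iff.2 hroots
  · rw [IntermediateField.adjoin_simple_le_iff]
    exact IntermediateField.adjoin.mono ℚ _ _ (Set.singleton_subset_iff.2 hr) ht

lemma cubic_mem_adjoin_singleton (t : ℂ) (a b c d : ℚ) :
    a + b * t + c * t ^ 2 + d * t ^ 3 ∈ IntermediateField.adjoin ℚ {t} := by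
  have ht := IntermediateField.mem_adjoin_simple_self ℚ t
  have hq (q : ℚ) : (q : ℂ) ∈ IntermediateField.adjoin ℚ {t} :=
    SubfieldClass.ratCast_mem _ q
  exact add_mem (add_mem (add_mem (hq a) (mul_mem (hq b) ht))
    (mul_mem (hq c) (pow_mem ht 2))) (mul_mem (hq d) (pow_mem ht 3))

/-- If `f` splits with roots given by cubic polynomials in `t`, and `t` is a cubic polynomial in
the first of these roots, then the splitting field of `f` in `ℂ` is `ℚ(t)`. -/
lemma adjoin_rootSet_eq_of_cubics {f : ℚ[X]} {t : ℂ} (hf : f ≠ 0) (a b c d : Fin 4 → ℚ)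
    {r : Fin 4 → ℂ} (hr : ∀ i, r i = a i + b i * t + c i * t ^ 2 + d i * t ^ 3)
    (hprod : ∀ z : ℂ, aeval z f = (z - r 0) * (z - r 1) * (z - r 2) * (z - r 3))
    (k l m n : ℚ) (ht : t = k + l * r 0 + m * r 0 ^ 2 + n * r 0 ^ 3) :
    IntermediateField.adjoin ℚ (f.rootSet ℂ) = IntermediateField.adjoin ℚ {t} := by
  have hmem (i : Fin 4) : r i ∈ IntermediateField.adjoin ℚ {t} := by
    rw [hr]
    exact cubic_mem_adjoin_singleton _ _ _ _ _
  refine adjoin_rootSet_eq_adjoin_singleton (r := r 0) (fun z hz ↦ ?_) ?_ ?_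
  · rw [mem_rootSet, hprod] at hz
    simp only [mul_eq_zero, sub_eq_zero] at hz
    obtain ⟨-, ((rfl | rfl) | rfl) | rfl⟩ := hz <;> exact hmem _
  · simp [mem_rootSet, hf, hprod]
  · nth_rewrite 1 [ht]
    exact cubic_mem_adjoin_singleton _ _ _ _ _

lemma IsPrimitiveRoot.add_inv_quartic_eq_zero {ζ : ℂ} (hζ : IsPrimitiveRoot ζ 15) :
    (ζ + ζ⁻¹) ^ 4 - (ζ + ζ⁻¹) ^ 3 - 4 * (ζ + ζ⁻¹) ^ 2 + 4 * (ζ + ζ⁻¹) + 1 = 0 := by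
  have h0 : ζ ≠ 0 := hζ.ne_zero (by norm_num)
  have h5 : ζ ^ 5 - 1 ≠ 0 := sub_ne_zero.2 (hζ.pow_ne_one_of_pos_of_lt (by norm_num) (by norm_num))
  have h3 : ζ ^ 3 - 1 ≠ 0 := sub_ne_zero.2 (hζ.pow_ne_one_of_pos_of_lt (by norm_num) (by norm_num))
  have hcyc : ζ ^ 8 - ζ ^ 7 + ζ ^ 5 - ζ ^ 4 + ζ ^ 3 - ζ + 1 = 0 := by
    apply mul_left_cancel₀ (mul_ne_zero h5 h3)
    linear_combination (ζ - 1) * hζ.pow_eq_one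
  field_simp
  linear_combination hcyc

/-- The splitting fields (inside `ℂ`) of `f₀(x) = x⁴+12x³+14x²-12x+1` and of
`g₀(x) = x⁴-228x³+494x²+228x+1` over `ℚ` both equal `ℚ(ζ₁₅ + ζ₁₅⁻¹)`, the maximal
real subfield of the 15th cyclotomic field, where `ζ₁₅ = e^{2πi/15}`. -/
theorem splitting_fields_f0_g0 :
    IntermediateField.adjoin ℚ
        ((X ^ 4 + 12 * X ^ 3 + 14 * X ^ 2 - 12 * X + 1 : ℚ[X]).rootSet ℂ) =
      IntermediateField.adjoin ℚ
        {Complex.exp (2 * Real.pi * Complex.I / 15) +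
          (Complex.exp (2 * Real.pi * Complex.I / 15))⁻¹} ∧
    IntermediateField.adjoin ℚ
        ((X ^ 4 - 228 * X ^ 3 + 494 * X ^ 2 + 228 * X + 1 : ℚ[X]).rootSet ℂ) =
      IntermediateField.adjoin ℚ
        {Complex.exp (2 * Real.pi * Complex.I / 15) +
          (Complex.exp (2 * Real.pi * Complex.I / 15))⁻¹} := by
  have hζ : IsPrimitiveRoot (Complex.exp (2 * Real.pi * Complex.I / 15)) 15 :=
    mod_cast Complex.isPrimitiveRoot_exp 15 (by norm_num)
  have ht := hζ.add_inv_quartic_eq_zero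
  generalize Complex.exp (2 * Real.pi * Complex.I / 15) +
    (Complex.exp (2 * Real.pi * Complex.I / 15))⁻¹ = t at ht ⊢
  constructor
  · refine adjoin_rootSet_eq_of_cubics (Monic.ne_zero (by monicity!))
      ![1, -9, -5, 1] ![2, 8, -14, 4] ![-2, 2, 2, -2] ![0, -2, 4, -2] (fun _ ↦ rfl) (fun z ↦ ?_)
      (13 / 8) (-23 / 8) (-13 / 8) (-1 / 8) ?_
    · simp [aeval_def]
      grind
    · simp
      grind
  · refine adjoin_rootSet_eq_of_cubics (Monic.ne_zero (by monicity!))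
      ![-3, 197, 67, -33] ![-20, -150, 320, -150] ![30, -50, -30, 50] ![-10, 40, -90, 60]
      (fun _ ↦ rfl) (fun z ↦ ?_)
      (1333 / 1000) (-1187 / 1000) (231 / 1000) (-1 / 1000) ?_
    · simp [aeval_def]
      grind
    · simp
      grind
end

section
/- The splitting field of f₁₇₂₈(x) = x⁴ + 18x³ + 74x² − 18x + 1 over ℚ and the splitting field of g₁₇₂₈(x) = x⁴ + 522x³ − 10006x² − 522x + 1 over ℚ are both equal to ℚ(ζ₂₀ + ζ₂₀⁻¹), the maximal real subfield of the 20th cyclotomic field. -/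
open Polynomial

/-- The generator `ζ₂₀ + ζ₂₀⁻¹` is a root of `x⁴ - 5x² + 5`. -/
theorem quartic_of_isPrimitiveRoot_twenty {K : Type*} [Field K] {z : K}
    (hz : IsPrimitiveRoot z 20) : (z + z⁻¹) ^ 4 - 5 * (z + z⁻¹) ^ 2 + 5 = 0 := by
  have hz0 : z ≠ 0 := hz.ne_zero (by norm_num)
  have h4 : z ^ 4 ≠ 1 := hz.pow_ne_one_of_pos_of_lt (by norm_num) (by norm_num)
  have h10 : z ^ 10 ≠ 1 := hz.pow_ne_one_of_pos_of_lt (by norm_num) (by norm_num)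
  have hneg : z ^ 10 + 1 = 0 := by
    refine (mul_eq_zero.mp ?_).resolve_left (sub_ne_zero.mpr h10)
    linear_combination hz.pow_eq_one
  have hsq : z ^ 2 + 1 ≠ 0 := fun h => h4 (by linear_combination (z ^ 2 - 1) * h)
  have hcyc : z ^ 8 - z ^ 6 + z ^ 4 - z ^ 2 + 1 = 0 := by
    refine (mul_eq_zero.mp ?_).resolve_left hsq
    linear_combination hneg
  field_simp
  linear_combination hcyc

/-- The splitting field of a rational polynomial with roots `a, b, d, e` equals `ℚ(c)` as soon as
these roots lie in `ℚ(c)` and `c` lies in every field containing them. -/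
theorem adjoin_rootSet_eq_adjoin_simple {K : Type*} [Field K] [Algebra ℚ K] {p : ℚ[X]}
    {a b d e c : K} (hp : p ≠ 0)
    (hroots : ∀ x, aeval x p = (x - a) * (x - b) * (x - d) * (x - e))
    (hmem : ∀ x ∈ ({a, b, d, e} : Set K), x ∈ IntermediateField.adjoin ℚ {c})
    (hc : ∀ L : IntermediateField ℚ K, a ∈ L → b ∈ L → d ∈ L → e ∈ L → c ∈ L) :
    IntermediateField.adjoin ℚ (p.rootSet K) = IntermediateField.adjoin ℚ {c} := by
  have hset : p.rootSet K = {a, b, d, e} := by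
    ext x
    simp [mem_rootSet, hp, hroots, sub_eq_zero, or_assoc]
  rw [hset]
  apply le_antisymm
  · exact IntermediateField.adjoin_le_iff.mpr hmem
  · refine IntermediateField.adjoin_simple_le_iff.mpr (hc _ ?_ ?_ ?_ ?_) <;>
      exact IntermediateField.subset_adjoin ℚ _ (by simp)

/-- Integer polynomial expressions of degree at most three in `c` lie in `ℚ(c)`. -/
theorem cubic_mem_adjoin_simple {K : Type*} [Field K] [Algebra ℚ K] (c : K) (k l m n : ℤ) :
    (k + l * c + m * c ^ 2 + n * c ^ 3 : K) ∈ IntermediateField.adjoin ℚ {c} := by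
  have hc := IntermediateField.mem_adjoin_simple_self ℚ c
  exact add_mem (add_mem (add_mem (intCast_mem _ k) (mul_mem (intCast_mem _ l) hc))
    (mul_mem (intCast_mem _ m) (pow_mem hc 2))) (mul_mem (intCast_mem _ n) (pow_mem hc 3))

/-- The splitting field of `f₁₇₂₈` is generated by any root of `x⁴ - 5x² + 5`. -/
theorem adjoin_rootSet_f1728 {K : Type*} [Field K] [Algebra ℚ K] {c : K}
    (hc : c ^ 4 - 5 * c ^ 2 + 5 = 0) :
    IntermediateField.adjoin ℚ
        ((X ^ 4 + 18 * X ^ 3 + 74 * X ^ 2 - 18 * X + 1 : ℚ[X]).rootSet K) =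
      IntermediateField.adjoin ℚ {c} := by
  have : CharZero K := algebraRat.charZero K
  have hmem := cubic_mem_adjoin_simple c
  refine adjoin_rootSet_eq_adjoin_simple
    (a := ((-2 : ℤ) : K) + ((3 : ℤ) : K) * c + ((-1 : ℤ) : K) * c ^ 2 + ((0 : ℤ) : K) * c ^ 3)
    (b := ((-2 : ℤ) : K) + ((-3 : ℤ) : K) * c + ((-1 : ℤ) : K) * c ^ 2 + ((0 : ℤ) : K) * c ^ 3)
    (d := ((-7 : ℤ) : K) + ((-9 : ℤ) : K) * c + ((1 : ℤ) : K) * c ^ 2 + ((3 : ℤ) : K) * c ^ 3)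
    (e := ((-7 : ℤ) : K) + ((9 : ℤ) : K) * c + ((1 : ℤ) : K) * c ^ 2 + ((-3 : ℤ) : K) * c ^ 3)
    ?_ (fun x => ?_) ?_ (fun L ha hb hd he => ?_)
  · intro h
    simpa using congrArg (eval 0) h
  · simp only [map_add, map_sub, map_mul, map_pow, map_one, aeval_X, map_ofNat]
    push_cast
    linear_combination
      -((39 + (-86) * c ^ 2 + 55 * c ^ 4 + (-9) * c ^ 6)
        + (54 + (-18) * c ^ 2 + (-18) * c ^ 4) * x
        + (7 + (-9) * c ^ 2) * x ^ 2) * hc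
  · rintro x (rfl | rfl | rfl | rfl) <;> exact hmem _ _ _ _
  · convert L.smul_mem (sub_mem ha hb) (x := (1 / 6 : ℚ)) using 1
    rw [Algebra.smul_def]
    simp only [map_div₀, map_one, map_ofNat]
    push_cast
    ring

/-- The splitting field of `g₁₇₂₈` is generated by any root of `x⁴ - 5x² + 5`. -/
theorem adjoin_rootSet_g1728 {K : Type*} [Field K] [Algebra ℚ K] {c : K}
    (hc : c ^ 4 - 5 * c ^ 2 + 5 = 0) :
    IntermediateField.adjoin ℚ
        ((X ^ 4 + 522 * X ^ 3 - 10006 * X ^ 2 - 522 * X + 1 : ℚ[X]).rootSet K) =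
      IntermediateField.adjoin ℚ {c} := by
  have : CharZero K := algebraRat.charZero K
  have hmem := cubic_mem_adjoin_simple c
  refine adjoin_rootSet_eq_adjoin_simple
    (a := ((182 : ℤ) : K) + ((-75 : ℤ) : K) * c + ((-125 : ℤ) : K) * c ^ 2 + ((60 : ℤ) : K) * c ^ 3)
    (b := ((182 : ℤ) : K) + ((75 : ℤ) : K) * c + ((-125 : ℤ) : K) * c ^ 2 + ((-60 : ℤ) : K) * c ^ 3)
    (d := ((-443 : ℤ) : K) + ((-375 : ℤ) : K) * c + ((125 : ℤ) : K) * c ^ 2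
      + ((105 : ℤ) : K) * c ^ 3)
    (e := ((-443 : ℤ) : K) + ((375 : ℤ) : K) * c + ((125 : ℤ) : K) * c ^ 2
      + ((-105 : ℤ) : K) * c ^ 3)
    ?_ (fun x => ?_) ?_ (fun L ha hb hd he => ?_)
  · intro h
    simpa using congrArg (eval 0) h
  · simp only [map_add, map_sub, map_mul, map_pow, map_one, aeval_X, map_ofNat]
    push_cast
    linear_combination
      -((1300110375 + (-2371844750) * c ^ 2 + 1530184375 * c ^ 4
        + (-412790625) * c ^ 6 + 39690000 * c ^ 8)
        + ((-8417250) + 8979750 * c ^ 2 + (-1856250) * c ^ 4) * x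
        + ((-16625) + (-14625) * c ^ 2) * x ^ 2) * hc
  · rintro x (rfl | rfl | rfl | rfl) <;> exact hmem _ _ _ _
  · convert L.smul_mem (sub_mem (mul_mem (ofNat_mem L 7) (sub_mem ha hb))
      (mul_mem (ofNat_mem L 4) (sub_mem hd he))) (x := (1 / 1950 : ℚ)) using 1
    rw [Algebra.smul_def]
    simp only [map_div₀, map_one, map_ofNat]
    push_cast
    ring

/-- The splitting fields (inside `ℂ`) of `f₁₇₂₈(x) = x⁴+18x³+74x²-18x+1` and of
`g₁₇₂₈(x) = x⁴+522x³-10006x²-522x+1` over `ℚ` both equal `ℚ(ζ₂₀ + ζ₂₀⁻¹)`, the maximal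
real subfield of the 20th cyclotomic field, where `ζ₂₀ = e^{2πi/20}`. -/
theorem splitting_fields_f1728_g1728 :
    IntermediateField.adjoin ℚ
        ((X ^ 4 + 18 * X ^ 3 + 74 * X ^ 2 - 18 * X + 1 : ℚ[X]).rootSet ℂ) =
      IntermediateField.adjoin ℚ
        {Complex.exp (2 * Real.pi * Complex.I / 20) +
          (Complex.exp (2 * Real.pi * Complex.I / 20))⁻¹} ∧
    IntermediateField.adjoin ℚ
        ((X ^ 4 + 522 * X ^ 3 - 10006 * X ^ 2 - 522 * X + 1 : ℚ[X]).rootSet ℂ) =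
      IntermediateField.adjoin ℚ
        {Complex.exp (2 * Real.pi * Complex.I / 20) +
          (Complex.exp (2 * Real.pi * Complex.I / 20))⁻¹} := by
  have hc := quartic_of_isPrimitiveRoot_twenty (Complex.isPrimitiveRoot_exp 20 (by norm_num))
  push_cast at hc
  exact ⟨adjoin_rootSet_f1728 hc, adjoin_rootSet_g1728 hc⟩
end

section
/- Let l > 5 be a prime with l ≡ 4 (mod 5). Then there is no a ∈ 𝔽_l such that the polynomial x² + ax − 1 is irreducible over 𝔽_l and divides Ĥ_{5,l}(x) in 𝔽_l[x]. -/
open Polynomial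

/-- The Hasse invariant `Ĥ_{5,l}(x)` of the Tate normal form `E₅` for a point of
order 5, as a polynomial over `𝔽_l = ZMod l`.  Here `n_l = ⌊l/12⌋`,
`r = 1` iff `l ≡ 2 (mod 3)`, `s = 1` iff `l ≡ 3 (mod 4)`. -/
noncomputable def H5 (l : ℕ) : Polynomial (ZMod l) :=
  (X ^ 4 + 12 * X ^ 3 + 14 * X ^ 2 - 12 * X + 1) ^ (if l % 3 = 2 then 1 else 0) *
  (X ^ 2 + 1) ^ (if l % 4 = 3 then 1 else 0) *
  (X ^ 4 + 18 * X ^ 3 + 74 * X ^ 2 - 18 * X + 1) ^ (if l % 4 = 3 then 1 else 0) *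
  ∑ k ∈ Finset.range (l / 12 + 1),
    (Nat.choose (2 * (l / 12) + (if l % 4 = 3 then 1 else 0))
        (2 * k + (if l % 4 = 3 then 1 else 0)) : Polynomial (ZMod l)) *
    (Nat.choose (2 * (l / 12) - 2 * k) (l / 12 - k) : Polynomial (ZMod l)) *
    (-432) ^ (l / 12 - k) *
    ((X ^ 4 + 12 * X ^ 3 + 14 * X ^ 2 - 12 * X + 1) ^ 3 -
        1728 * (X ^ 5 * (1 - 11 * X - X ^ 2))) ^ k *
    (X ^ 5 * (1 - 11 * X - X ^ 2)) ^ (l / 12 - k)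

/-- The short Weierstrass curve `y² = x³ + A x + B`. -/
def shortCurve {F : Type*} [Field F] (A B : F) : WeierstrassCurve.Affine F :=
  ⟨0, 0, 0, A, B⟩

theorem fiveDivisionPolynomial_eq_zero_of_five_nsmul {F : Type*} [Field F] [DecidableEq F]
    {A B : F} {P : (shortCurve A B).Point} (hP : P ≠ 0) (h5 : 5 • P = 0) :
    ∃ x : F, 32 * (x ^ 3 + A * x + B) ^ 2 * (3 * x ^ 2 + A) *
        (3 * x ^ 4 + 6 * A * x ^ 2 + 12 * B * x - A ^ 2) -
      (3 * x ^ 4 + 6 * A * x ^ 2 + 12 * B * x - A ^ 2) ^ 3 -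
      256 * (x ^ 3 + A * x + B) ^ 4 = 0 := by
  have key : P + (P + P) = -(P + P) := by
    rw [eq_neg_iff_add_eq_zero, ← h5]; abel
  have h2 : P + P ≠ 0 := by
    intro h
    apply hP
    rw [h] at key
    simpa using key
  have h1 : P ≠ P + P := by
    intro h
    exact hP (by simpa using h)
  have h3 : P ≠ -(P + P) := by
    intro h
    rw [← key] at h
    exact h2 (by simpa using h)
  rcases P with _ | ⟨x, y, hxy⟩
  · exact absurd rfl hP
  refine ⟨x, ?_⟩
  have heq : y ^ 2 = x ^ 3 + A * x + B := by
    have := (WeierstrassCurve.Affine.equation_iff x y).1 hxy.1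
    simpa [shortCurve] using this
  have hy : y ≠ (shortCurve A B).negY x y := by
    intro h
    exact h2 (WeierstrassCurve.Affine.Point.add_self_of_Y_eq h)
  have hy2 : y + y ≠ 0 := by
    intro h
    apply hy
    simp only [WeierstrassCurve.Affine.negY, shortCurve]
    linear_combination h
  obtain ⟨X, Y, hXY, hadd, hX, hY⟩ : ∃ X Y, ∃ h : (shortCurve A B).Nonsingular X Y,
      WeierstrassCurve.Affine.Point.some _ _ hxy + WeierstrassCurve.Affine.Point.some _ _ hxy =
        WeierstrassCurve.Affine.Point.some _ _ h ∧
      X = ((3 * x ^ 2 + A) / (y + y)) ^ 2 - 2 * x ∧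
      Y = -(y + (3 * x ^ 2 + A) / (y + y) * (X - x)) := by
    refine ⟨_, _, _, WeierstrassCurve.Affine.Point.add_self_of_Y_ne hy, ?_, ?_⟩
    · rw [WeierstrassCurve.Affine.slope_of_Y_ne rfl hy]
      simp only [WeierstrassCurve.Affine.addX, WeierstrassCurve.Affine.negY, shortCurve]
      ring
    · rw [WeierstrassCurve.Affine.slope_of_Y_ne rfl hy]
      simp only [WeierstrassCurve.Affine.addY, WeierstrassCurve.Affine.negAddY,
        WeierstrassCurve.Affine.addX, WeierstrassCurve.Affine.negY, shortCurve]
      ring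
  rw [hadd] at key h1 h3
  have hxX : x ≠ X := by
    intro h
    rcases WeierstrassCurve.Affine.Point.X_eq_iff (h₁ := hxy) (h₂ := hXY) |>.1 h with h | h
    · exact h1 h
    · exact h3 h
  rw [WeierstrassCurve.Affine.Point.add_of_X_ne hxX, WeierstrassCurve.Affine.Point.neg_some,
    WeierstrassCurve.Affine.Point.some.injEq] at key
  have hx := key.1
  rw [WeierstrassCurve.Affine.slope_of_X_ne hxX] at hx
  simp only [WeierstrassCurve.Affine.addX, shortCurve] at hx
  have hsub : x - X ≠ 0 := sub_ne_zero.2 hxX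
  have hchord : (Y - y) ^ 2 = (x + 2 * X) * (X - x) ^ 2 := by
    field_simp at hx
    linear_combination hx
  set m := (3 * x ^ 2 + A) / (y + y) with hm
  have hmy : 2 * (m * y) = 3 * x ^ 2 + A := by
    have := div_mul_cancel₀ (3 * x ^ 2 + A) hy2
    rw [← hm] at this
    linear_combination this
  set u := X - x with hu
  have hm2 : m ^ 2 = u + 3 * x := by rw [hu, hX]; ring
  have hcube : u ^ 3 = 2 * (3 * x ^ 2 + A) * u + 4 * (x ^ 3 + A * x + B) := by
    have hXu : X = u + x := by rw [hu]; ring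
    rw [hY, hXu] at hchord
    linear_combination -hchord + u ^ 2 * hm2 + 2 * u * hmy + 4 * heq
  have hpsi : 4 * (x ^ 3 + A * x + B) * u = -(3 * x ^ 4 + 6 * A * x ^ 2 + 12 * B * x - A ^ 2) := by
    linear_combination (2 * m * y + 3 * x ^ 2 + A) * hmy - 4 * y ^ 2 * hm2 -
      (4 * u + 12 * x) * heq
  set f := x ^ 3 + A * x + B
  set p := 3 * x ^ 4 + 6 * A * x ^ 2 + 12 * B * x - A ^ 2
  have hp : p = -(4 * f * u) := by rw [hpsi]; ring
  rw [hp]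
  linear_combination 64 * f ^ 3 * hcube

theorem eq_zero_of_five_nsmul_eq_zero {F : Type*} [Field F] [DecidableEq F]
    {a w : F} (hw : w ^ 2 = 5) (hd : ¬ IsSquare (a ^ 2 + 4)) (h6 : (6 : F) ≠ 0)
    (h5 : (5 : F) ≠ 0)
    {P : (shortCurve (-3 * ((a ^ 2 - 12 * a + 16) * (a ^ 2 + 4)))
      (2 * ((a ^ 2 - 18 * a + 76) * (a ^ 2 + 4) ^ 2))).Point} (hP : 5 • P = 0) : P = 0 := by
  by_contra hne
  obtain ⟨x, hx⟩ := fiveDivisionPolynomial_eq_zero_of_five_nsmul hne hP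
  set d := a ^ 2 + 4 with hdef
  obtain ⟨z, rfl⟩ : ∃ z, x = z + d := ⟨x - d, by ring⟩
  have hK : z ^ 2 - 36 * d ≠ 0 := by
    intro h
    refine hd ⟨z / 6, ?_⟩
    field_simp
    linear_combination -h
  have ha : a - 11 ≠ 0 := by
    intro h
    refine hd ⟨5 * w, ?_⟩
    rw [hdef, eq_add_of_sub_eq h]
    linear_combination -25 * hw
  have hw0 : w ≠ 0 := by
    rintro rfl
    exact h5 (by rw [← hw]; ring)
  have hG : (z ^ 2 - 36 * d) * (5 * (z ^ 5 + 6 * d * z ^ 4 + 72 * d * (2 * a + 3) * z ^ 3 +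
      2160 * d ^ 2 * z ^ 2 + d ^ 2 * (15552 * a - 9072) * z + 38880 * d ^ 3) ^ 2 -
      36 * d * (a - 11) ^ 2 * (z ^ 2 - 36 * d) ^ 4) = 0 := by
    rw [← hx]
    simp only [hdef]
    ring
  have hG' := (mul_eq_zero.1 hG).resolve_left hK
  set G := z ^ 5 + 6 * d * z ^ 4 + 72 * d * (2 * a + 3) * z ^ 3 +
      2160 * d ^ 2 * z ^ 2 + d ^ 2 * (15552 * a - 9072) * z + 38880 * d ^ 3
  refine hd ⟨5 * G / (6 * w * (a - 11) * (z ^ 2 - 36 * d) ^ 2), ?_⟩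
  have h6w : 6 * w * (a - 11) * (z ^ 2 - 36 * d) ^ 2 ≠ 0 :=
    mul_ne_zero (mul_ne_zero (mul_ne_zero h6 hw0) ha) (pow_ne_zero 2 hK)
  rw [div_mul_div_comm, eq_div_iff (mul_ne_zero h6w h6w)]
  linear_combination -5 * hG' + 36 * d * (a - 11) ^ 2 * (z ^ 2 - 36 * d) ^ 4 * hw

theorem coeff_X_sq_add_C_pow {R : Type*} [CommRing R] (D : R) (p w : ℕ) :
    ((X ^ 2 + C D) ^ p : R[X]).coeff (2 * w) = D ^ (p - w) * p.choose w := by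
  have h : ((X ^ 2 + C D) ^ p : R[X]) = expand R 2 ((X + C D) ^ p) := by simp
  rw [h, mul_comm 2 w, coeff_expand_mul (by norm_num), coeff_X_add_C_pow]

theorem coeff_X_sq_add_C_pow_of_odd {R : Type*} [CommRing R] (D : R) (p : ℕ) {q : ℕ}
    (hq : ¬ 2 ∣ q) : ((X ^ 2 + C D) ^ p : R[X]).coeff q = 0 := by
  have h : ((X ^ 2 + C D) ^ p : R[X]) = expand R 2 ((X + C D) ^ p) := by simp
  rw [h, coeff_expand (by norm_num), if_neg hq]

theorem coeff_quadratic_pow_eq_sum {R : Type*} [CommRing R] (c D : R) (n s : ℕ) (hs : s ≤ 1) :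
    ((X ^ 2 + C c * X + C D) ^ (2 * n + s) : R[X]).coeff (2 * n + s) =
      ∑ k ∈ Finset.range (n + 1), ((2 * n + s).choose (2 * k + s) : R) *
        ((2 * n - 2 * k).choose (n - k) : R) * c ^ (2 * k + s) * D ^ (n - k) := by
  have h : (X ^ 2 + C c * X + C D : R[X]) = C c * X + (X ^ 2 + C D) := by ring
  rw [h, add_pow, finsetSum_coeff]
  symm
  refine Finset.sum_of_injOn (fun k => 2 * k + s) ?_ ?_ ?_ ?_
  · intro i _ j _ hij
    simp only at hij
    omega
  · intro k hk
    simp only [Finset.coe_range, Set.mem_Iio] at hk ⊢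
    omega
  · intro j hj hj'
    have hodd : ¬ 2 ∣ 2 * n + s - j := by
      intro hdvd
      apply hj'
      rw [Finset.mem_range] at hj
      refine ⟨(j - s) / 2, ?_, ?_⟩
      · simp only [Finset.coe_range, Set.mem_Iio]; omega
      · simp only; omega
    rw [Finset.mem_range] at hj
    rw [mul_pow, ← C_pow, mul_assoc, mul_assoc, coeff_C_mul, coeff_X_pow_mul',
      if_pos (by omega), coeff_mul_natCast, coeff_X_sq_add_C_pow_of_odd _ _ hodd]
    simp
  · intro k hk
    rw [Finset.mem_range] at hk
    rw [mul_pow, ← C_pow, coeff_mul_natCast, mul_assoc (C _), coeff_C_mul, coeff_X_pow_mul',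
      if_pos (by omega),
      show 2 * n + s - (2 * k + s) = 2 * (n - k) by omega, coeff_X_sq_add_C_pow,
      show 2 * n - 2 * k = 2 * (n - k) by omega, show 2 * (n - k) - (n - k) = n - k by omega]
    ring

theorem coeff_completed_square_pow_eq_sum {R : Type*} [CommRing R] (h q : R) (N : ℕ) :
    (((X + C h) ^ 2 + C q) ^ N : R[X]).coeff N =
      ∑ i ∈ Finset.range (N / 2 + 1), (N.choose i : R) * ((2 * N - 2 * i).choose N : R) *
        q ^ i * h ^ (N - 2 * i) := by
  rw [add_comm, add_pow, finsetSum_coeff]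
  symm
  have hterm : ∀ i ∈ Finset.range (N + 1),
      (C q ^ i * ((X + C h) ^ 2) ^ (N - i) * (N.choose i : R[X])).coeff N =
        (N.choose i : R) * ((2 * N - 2 * i).choose N : R) * q ^ i * h ^ (N - 2 * i) := by
    intro i hi
    rw [Finset.mem_range] at hi
    rw [coeff_mul_natCast, ← C_pow, coeff_C_mul, ← pow_mul, coeff_X_add_C_pow,
      show 2 * (N - i) = 2 * N - 2 * i by omega, show 2 * N - 2 * i - N = N - 2 * i by omega]
    ring
  rw [Finset.sum_congr rfl hterm]
  refine Finset.sum_subset (fun i hi => ?_) (fun i hi' hi => ?_)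
  · rw [Finset.mem_range] at *; omega
  · rw [Finset.mem_range] at hi hi'
    rw [Nat.choose_eq_zero_of_lt (show 2 * N - 2 * i < N by omega)]
    simp

theorem coeff_cubic_pow_eq_sum {R : Type*} [CommRing R] (A B : R) (N r : ℕ) (hr : r ≤ 1) :
    ((X ^ 3 + C A * X + C B) ^ (3 * N + 2 * r) : R[X]).coeff (6 * N + 4 * r) =
      ∑ i ∈ Finset.range (N / 2 + 1), ((3 * N + 2 * r).choose (N - 2 * i) : R) *
        ((2 * N + 2 * r + 2 * i).choose (2 * N + r - i) : R) *
        A ^ (r + 3 * i) * B ^ (N - 2 * i) := by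
  have h : (X ^ 3 + C A * X + C B : R[X]) = C B + X * (X ^ 2 + C A) := by ring
  rw [h, add_pow, finsetSum_coeff]
  symm
  have hterm : ∀ k ≤ 3 * N + 2 * r, (C B ^ k * (X * (X ^ 2 + C A)) ^ (3 * N + 2 * r - k) *
      ((3 * N + 2 * r).choose k : R[X])).coeff (6 * N + 4 * r) =
        B ^ k * ((X ^ 2 + C A) ^ (3 * N + 2 * r - k) : R[X]).coeff (3 * N + 2 * r + k) *
          (3 * N + 2 * r).choose k := by
    intro k hk
    rw [coeff_mul_natCast, ← C_pow, coeff_C_mul, mul_pow, coeff_X_pow_mul', if_pos (by omega),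
      show 6 * N + 4 * r - (3 * N + 2 * r - k) = 3 * N + 2 * r + k by omega]
  refine Finset.sum_of_injOn (fun i => N - 2 * i) ?_ ?_ ?_ ?_
  · intro i hi j hj hij
    simp only [Finset.coe_range, Set.mem_Iio] at hi hj hij
    omega
  · intro k hk
    simp only [Finset.coe_range, Set.mem_Iio] at hk ⊢
    omega
  · intro k hk hk'
    rw [Finset.mem_range] at hk
    rw [hterm k (by omega)]
    by_cases hdvd : 2 ∣ 3 * N + 2 * r + k
    · obtain ⟨w, hw⟩ := hdvd
      have hkN : N < k := by
        by_contra hle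
        apply hk'
        refine ⟨(N - k) / 2, ?_, ?_⟩
        · simp only [Finset.coe_range, Set.mem_Iio]; omega
        · simp only; omega
      rw [hw, coeff_X_sq_add_C_pow,
        Nat.choose_eq_zero_of_lt (show 3 * N + 2 * r - k < w by omega)]
      simp
    · rw [coeff_X_sq_add_C_pow_of_odd _ _ hdvd]
      simp
  · intro i hi
    rw [Finset.mem_range] at hi
    rw [hterm _ (by omega), show 3 * N + 2 * r + (N - 2 * i) = 2 * (2 * N + r - i) by omega,
      coeff_X_sq_add_C_pow,
      show 3 * N + 2 * r - (N - 2 * i) = 2 * N + 2 * r + 2 * i by omega,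
      show 2 * N + 2 * r + 2 * i - (2 * N + r - i) = r + 3 * i by omega]
    ring

theorem trinomial_succ_mul (i j r : ℕ) :
    (6 * i + 6 + 3 * j + 2 * r).choose j *
        (6 * i + 6 + 2 * j + 2 * r).choose (3 * i + 3 + 2 * j + r) *
        ((r + 3 * i + 1) * (r + 3 * i + 2) * (r + 3 * i + 3)) =
      (6 * i + 6 + 3 * j + 2 * r).choose (j + 2) *
        (6 * i + 4 + 2 * j + 2 * r).choose (3 * i + 4 + 2 * j + r) *
        ((3 * i + 4 + 2 * j + r) * ((j + 2) * (j + 1))) := by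
  have e1 := Nat.choose_mul_factorial_mul_factorial
    (show j ≤ 6 * i + 6 + 3 * j + 2 * r by omega)
  have e2 := Nat.choose_mul_factorial_mul_factorial
    (show 3 * i + 3 + 2 * j + r ≤ 6 * i + 6 + 2 * j + 2 * r by omega)
  have e3 := Nat.choose_mul_factorial_mul_factorial
    (show j + 2 ≤ 6 * i + 6 + 3 * j + 2 * r by omega)
  have e4 := Nat.choose_mul_factorial_mul_factorial
    (show 3 * i + 4 + 2 * j + r ≤ 6 * i + 4 + 2 * j + 2 * r by omega)
  rw [show 6 * i + 6 + 3 * j + 2 * r - j = 6 * i + 6 + 2 * j + 2 * r by omega, ← e2] at e1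
  rw [show 6 * i + 6 + 3 * j + 2 * r - (j + 2) = 6 * i + 4 + 2 * j + 2 * r by omega, ← e4] at e3
  rw [show 6 * i + 6 + 2 * j + 2 * r - (3 * i + 3 + 2 * j + r) = r + 3 * i + 3 by omega] at e1
  rw [show 6 * i + 4 + 2 * j + 2 * r - (3 * i + 4 + 2 * j + r) = r + 3 * i by omega] at e3
  have f1 : (j + 2).factorial = (j + 2) * ((j + 1) * j.factorial) := rfl
  have f2 : (3 * i + 4 + 2 * j + r).factorial =
      (3 * i + 4 + 2 * j + r) * (3 * i + 3 + 2 * j + r).factorial := by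
    rw [show 3 * i + 4 + 2 * j + r = (3 * i + 3 + 2 * j + r) + 1 by omega, Nat.factorial_succ]
  have f3 : (r + 3 * i + 3).factorial =
      (r + 3 * i + 3) * ((r + 3 * i + 2) * ((r + 3 * i + 1) * (r + 3 * i).factorial)) := rfl
  rw [f3] at e1
  rw [f1, f2] at e3
  have hpos : 0 < j.factorial * (3 * i + 3 + 2 * j + r).factorial * (r + 3 * i).factorial := by
    positivity
  refine Nat.eq_of_mul_eq_mul_right hpos ?_
  have e := e1.trans e3.symm
  linear_combination e

theorem legendre_coeff_succ_mul (i j : ℕ) :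
    (2 * i + 2 + j).choose (i + 1) * (2 * i + 2 + 2 * j).choose (2 * i + 2 + j) *
        (2 * (i + 1) * (2 * i + 2 * j + 3)) =
      (2 * i + 2 + j).choose i * (2 * i + 4 + 2 * j).choose (2 * i + 2 + j) *
        ((j + 2) * (j + 1)) := by
  have e1 := Nat.choose_mul_factorial_mul_factorial (show i + 1 ≤ 2 * i + 2 + j by omega)
  have e2 := Nat.choose_mul_factorial_mul_factorial
    (show 2 * i + 2 + j ≤ 2 * i + 2 + 2 * j by omega)
  have e3 := Nat.choose_mul_factorial_mul_factorial (show i ≤ 2 * i + 2 + j by omega)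
  have e4 := Nat.choose_mul_factorial_mul_factorial
    (show 2 * i + 2 + j ≤ 2 * i + 4 + 2 * j by omega)
  rw [show 2 * i + 2 + j - (i + 1) = i + j + 1 by omega] at e1
  rw [show 2 * i + 2 + j - i = i + j + 2 by omega] at e3
  rw [show 2 * i + 2 + 2 * j - (2 * i + 2 + j) = j by omega] at e2
  rw [show 2 * i + 4 + 2 * j - (2 * i + 2 + j) = j + 2 by omega] at e4
  have f1 : (j + 2).factorial = (j + 2) * ((j + 1) * j.factorial) := rfl
  have f2 : (i + 1).factorial = (i + 1) * i.factorial := rfl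
  have f3 : (i + j + 2).factorial = (i + j + 2) * (i + j + 1).factorial := rfl
  have f4 : (2 * i + 4 + 2 * j).factorial =
      (2 * i + 4 + 2 * j) * ((2 * i + 3 + 2 * j) * (2 * i + 2 + 2 * j).factorial) := by
    rw [show 2 * i + 4 + 2 * j = (2 * i + 2 + 2 * j) + 1 + 1 by omega, Nat.factorial_succ,
      Nat.factorial_succ]
    ring
  rw [f2] at e1
  rw [f3] at e3
  rw [f1, f4, ← e2] at e4
  have hpos : 0 < (i.factorial * (i + j + 1).factorial) * (j.factorial * (i + j + 2) *
      (2 * i + 2 + j).factorial) := by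
    positivity
  refine Nat.eq_of_mul_eq_mul_right hpos ?_
  have e := e1.trans e3.symm
  generalize (2 * i + 2 + j).choose (i + 1) = u1 at *
  generalize (2 * i + 2 + 2 * j).choose (2 * i + 2 + j) = u2 at *
  generalize (2 * i + 2 + j).choose i = u3 at *
  generalize (2 * i + 4 + 2 * j).choose (2 * i + 2 + j) = u4 at *
  generalize (2 * i + 2 + j).factorial = g at *
  generalize j.factorial = g1 at *
  generalize i.factorial = g2 at *
  generalize (i + j + 1).factorial = g3 at *
  zify at *
  linear_combination (2 * (2 * (i : ℤ) + 2 * j + 3) * u2 * g * g1 * (i + j + 2)) * e -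
    u3 * g2 * g3 * (i + j + 2) * e4

theorem natCast_ne_zero_of_lt {l : ℕ} {n : ℕ} (h0 : 0 < n) (h : n < l) : (n : ZMod l) ≠ 0 := by
  rw [Ne, ZMod.natCast_eq_zero_iff]
  exact Nat.not_dvd_of_pos_of_lt h0 h

theorem trinomial_mul_legendre_coeff {l : ℕ} [Fact l.Prime] {N r : ℕ} (hr : r ≤ 1)
    (hl : l = 6 * N + 1 + 4 * r) (i : ℕ) (hi : 2 * i ≤ N) :
    (((3 * N + 2 * r).choose (N - 2 * i) : ZMod l) *
        ((2 * N + 2 * r + 2 * i).choose (2 * N + r - i) : ZMod l) *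
        (-3) ^ (r + 3 * i) * 2 ^ (N - 2 * i)) * ((2 * N).choose N : ZMod l) =
      (((3 * N + 2 * r).choose N : ZMod l) * ((2 * N + 2 * r).choose (2 * N + r) : ZMod l) *
        (-3) ^ r * 2 ^ N) *
      ((N.choose i : ZMod l) * ((2 * N - 2 * i).choose N : ZMod l) * (-1) ^ i) := by
  induction i with
  | zero => simp
  | succ i ih =>
    have ih := ih (by omega)
    obtain ⟨j, rfl⟩ : ∃ j, N = 2 * i + 2 + j := ⟨N - (2 * i + 2), by omega⟩
    have hT := congrArg (Nat.cast (R := ZMod l)) (trinomial_succ_mul i j r)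
    have hL := congrArg (Nat.cast (R := ZMod l)) (legendre_coeff_succ_mul i j)
    rw [show 3 * (2 * i + 2 + j) + 2 * r = 6 * i + 6 + 3 * j + 2 * r by omega] at *
    rw [show 2 * i + 2 + j - 2 * i = j + 2 by omega,
      show 2 * (2 * i + 2 + j) + 2 * r + 2 * i = 6 * i + 4 + 2 * j + 2 * r by omega,
      show 2 * (2 * i + 2 + j) + r - i = 3 * i + 4 + 2 * j + r by omega,
      show 2 * (2 * i + 2 + j) - 2 * i = 2 * i + 4 + 2 * j by omega] at ih
    rw [show 2 * i + 2 + j - 2 * (i + 1) = j by omega,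
      show 2 * (2 * i + 2 + j) + 2 * r + 2 * (i + 1) = 6 * i + 6 + 2 * j + 2 * r by omega,
      show 2 * (2 * i + 2 + j) + r - (i + 1) = 3 * i + 3 + 2 * j + r by omega,
      show 2 * (2 * i + 2 + j) - 2 * (i + 1) = 2 * i + 2 + 2 * j by omega]
    have hmod : (12 * i + 13 + 6 * j + 4 * r : ZMod l) = 0 := by
      have h : ((6 * (2 * i + 2 + j) + 1 + 4 * r : ℕ) : ZMod l) = 0 := by
        rw [← hl, ZMod.natCast_self]
      push_cast at h
      linear_combination h
    have ht : ((3 * i + 4 + 2 * j + r : ℕ) : ZMod l) ≠ 0 :=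
      natCast_ne_zero_of_lt (by omega) (by omega)
    have h27 : (27 : ZMod l) ≠ 0 := by
      have h3 : ((3 : ℕ) : ZMod l) ≠ 0 := natCast_ne_zero_of_lt (by omega) (by omega)
      have := pow_ne_zero 3 h3
      norm_num at this
      exact this
    have hQ : ((2 * (i + 1) * (2 * i + 2 * j + 3) : ℕ) : ZMod l) ≠ 0 := by
      push_cast
      have h1 : ((2 : ℕ) : ZMod l) ≠ 0 := natCast_ne_zero_of_lt (by omega) (by omega)
      have h2 : ((i + 1 : ℕ) : ZMod l) ≠ 0 := natCast_ne_zero_of_lt (by omega) (by omega)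
      have h3 : ((2 * i + 2 * j + 3 : ℕ) : ZMod l) ≠ 0 :=
        natCast_ne_zero_of_lt (by omega) (by omega)
      push_cast at h1 h2 h3
      exact mul_ne_zero (mul_ne_zero h1 h2) h3
    have hQT : (4 * ((r + 3 * i + 1) * (r + 3 * i + 2) * (r + 3 * i + 3)) : ZMod l) =
        27 * (3 * i + 4 + 2 * j + r) * (2 * (i + 1) * (2 * i + 2 * j + 3)) := by
      have h1 : (3 * (3 * i + 4 + 2 * j + r) : ZMod l) = -3 * i - 1 - r := by
        linear_combination hmod
      have h2 : (3 * (2 * i + 2 * j + 3) : ZMod l) = -6 * i - 4 - 4 * r := by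
        linear_combination hmod
      have hr' : r = 0 ∨ r = 1 := by omega
      rcases hr' with rfl | rfl
      · push_cast at *
        linear_combination (-(3 * (2 * (i + 1)) * (3 * (2 * i + 2 * j + 3)))) * h1 -
          3 * (-3 * i - 1 - 0) * (2 * (i + 1)) * h2
      · push_cast at *
        linear_combination (-(3 * (2 * (i + 1)) * (3 * (2 * i + 2 * j + 3)))) * h1 -
          3 * (-3 * i - 1 - 1) * (2 * (i + 1)) * h2
    push_cast at hT hL ht hQ
    rw [show r + 3 * (i + 1) = r + 3 * i + 3 by omega, pow_succ (-1 : ZMod l) i,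
      pow_add (-3 : ZMod l) (r + 3 * i) 3]
    rw [pow_add (2 : ZMod l) j 2] at ih
    generalize ((6 * i + 6 + 3 * j + 2 * r).choose (2 * i + 2 + j) : ZMod l) *
      ((2 * (2 * i + 2 + j) + 2 * r).choose (2 * (2 * i + 2 + j) + r) : ZMod l) *
        (-3) ^ r * 2 ^ (2 * i + 2 + j) = a0 at *
    generalize ((2 * (2 * i + 2 + j)).choose (2 * i + 2 + j) : ZMod l) = b0 at *
    generalize ((6 * i + 6 + 3 * j + 2 * r).choose j : ZMod l) *
      ((6 * i + 6 + 2 * j + 2 * r).choose (3 * i + 3 + 2 * j + r) : ZMod l) = T' at *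
    generalize ((6 * i + 6 + 3 * j + 2 * r).choose (j + 2) : ZMod l) *
      ((6 * i + 4 + 2 * j + 2 * r).choose (3 * i + 4 + 2 * j + r) : ZMod l) = T at *
    generalize ((2 * i + 2 + j).choose (i + 1) : ZMod l) *
      ((2 * i + 2 + 2 * j).choose (2 * i + 2 + j) : ZMod l) = L' at *
    generalize ((2 * i + 2 + j).choose i : ZMod l) *
      ((2 * i + 4 + 2 * j).choose (2 * i + 2 + j) : ZMod l) = L at *
    generalize (-3 : ZMod l) ^ (r + 3 * i) = p3 at *
    generalize (2 : ZMod l) ^ j = p2 at *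
    generalize (-1 : ZMod l) ^ i = p1 at *
    have hT' : T' * (2 * (i + 1) * (2 * i + 2 * j + 3)) * 27 = T * ((j + 2) * (j + 1)) * 4 := by
      refine mul_right_cancel₀ ht ?_
      linear_combination 4 * hT - T' * hQT
    refine mul_right_cancel₀ hQ ?_
    linear_combination (-p3 * p2 * b0) * hT' + a0 * p1 * hL - ((j + 2) * (j + 1)) * ih

theorem coeff_cubic_pow_eq_zero {l : ℕ} [Fact l.Prime] {n s r : ℕ} (hr : r ≤ 1) (hs : s ≤ 1)
    (hl : l = 6 * (2 * n + s) + 1 + 4 * r) (h5 : 5 < l) {c₄ c₆ D : ZMod l}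
    (hD : 4 * D = c₆ ^ 2 - c₄ ^ 3)
    (h : c₄ ^ r * ∑ k ∈ Finset.range (n + 1), ((2 * n + s).choose (2 * k + s) : ZMod l) *
        ((2 * n - 2 * k).choose (n - k) : ZMod l) * c₆ ^ (2 * k + s) * D ^ (n - k) = 0) :
    ((X ^ 3 + C (-3 * c₄) * X + C (2 * c₆)) ^ (l / 2) : (ZMod l)[X]).coeff (l - 1) = 0 := by
  have h2 : (2 : ZMod l) ≠ 0 := by
    have := natCast_ne_zero_of_lt (l := l) (n := 2) (by omega) (by omega)
    exact_mod_cast this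
  have h4 : (4 : ZMod l) ≠ 0 := by
    have := natCast_ne_zero_of_lt (l := l) (n := 4) (by omega) (by omega)
    exact_mod_cast this
  rw [← coeff_quadratic_pow_eq_sum _ _ _ _ hs] at h
  have hsq : (X ^ 2 + C c₆ * X + C D : (ZMod l)[X]) =
      (X + C (c₆ / 2)) ^ 2 + C (-(c₄ ^ 3) / 4) := by
    have e1 : 2 * (c₆ / 2) = c₆ := by field_simp
    have e2 : (c₆ / 2) ^ 2 + -(c₄ ^ 3) / 4 = D := by
      rw [div_pow, show (2 : ZMod l) ^ 2 = 4 by norm_num, ← add_div, div_eq_iff h4]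
      linear_combination -hD
    have h (t q : ZMod l) : (X ^ 2 + C (2 * t) * X + C (t ^ 2 + q) : (ZMod l)[X]) =
        (X + C t) ^ 2 + C q := by
      simp only [C_add, C_mul, C_pow, map_ofNat]
      ring
    rw [← h, e1, e2]
  rw [hsq, coeff_completed_square_pow_eq_sum] at h
  set N := 2 * n + s
  rw [show l / 2 = 3 * N + 2 * r by omega, show l - 1 = 6 * N + 4 * r by omega,
    coeff_cubic_pow_eq_sum _ _ _ _ hr]
  have hb : ((2 * N).choose N : ZMod l) ≠ 0 := by
    rw [Ne, ZMod.natCast_eq_zero_iff]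
    intro hdvd
    have h1 : l ∣ (2 * N).factorial := by
      rw [← Nat.choose_mul_factorial_mul_factorial (show N ≤ 2 * N by omega), mul_assoc]
      exact Dvd.dvd.mul_right hdvd _
    have := (Nat.Prime.dvd_factorial (Fact.out : l.Prime)).1 h1
    omega
  refine (mul_eq_zero.1 ?_).resolve_right hb
  rw [Finset.sum_mul]
  have hterm : ∀ i ∈ Finset.range (N / 2 + 1),
      ((3 * N + 2 * r).choose (N - 2 * i) : ZMod l) *
        ((2 * N + 2 * r + 2 * i).choose (2 * N + r - i) : ZMod l) *
        (-3 * c₄) ^ (r + 3 * i) * (2 * c₆) ^ (N - 2 * i) * ((2 * N).choose N : ZMod l) =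
      (((3 * N + 2 * r).choose N : ZMod l) * ((2 * N + 2 * r).choose (2 * N + r) : ZMod l) *
        (-3) ^ r * 2 ^ N * 2 ^ N) * (c₄ ^ r * ((N.choose i : ZMod l) *
          ((2 * N - 2 * i).choose N : ZMod l) * (-(c₄ ^ 3) / 4) ^ i *
          (c₆ / 2) ^ (N - 2 * i))) := by
    intro i hi
    rw [Finset.mem_range] at hi
    have key := trinomial_mul_legendre_coeff hr hl i (by omega)
    have e2 : (2 : ZMod l) ^ N = 4 ^ i * 2 ^ (N - 2 * i) := by
      rw [show (4 : ZMod l) = 2 ^ 2 by norm_num, ← pow_mul, ← pow_add]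
      congr 1
      omega
    have e3 : (2 : ZMod l) ^ N * ((-(c₄ ^ 3) / 4) ^ i * (c₆ / 2) ^ (N - 2 * i)) =
        (-1) ^ i * c₄ ^ (3 * i) * c₆ ^ (N - 2 * i) := by
      rw [e2, div_pow, div_pow, neg_pow, ← pow_mul]
      field_simp
    rw [mul_pow, mul_pow, pow_add c₄]
    linear_combination (c₄ ^ r * c₄ ^ (3 * i) * c₆ ^ (N - 2 * i)) * key -
      (((3 * N + 2 * r).choose N : ZMod l) * ((2 * N + 2 * r).choose (2 * N + r) : ZMod l) *
        (-3) ^ r * 2 ^ N * c₄ ^ r * ((N.choose i : ZMod l) *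
          ((2 * N - 2 * i).choose N : ZMod l))) * e3
  rw [Finset.sum_congr rfl hterm, ← Finset.mul_sum, ← Finset.mul_sum, h, mul_zero]

theorem X_pow_sub_X_dvd_of_forall_eval_eq_zero {l : ℕ} [Fact l.Prime] {p : (ZMod l)[X]}
    (h : ∀ x, p.eval x = 0) : X ^ l - X ∣ p := by
  rcases eq_or_ne p 0 with rfl | hp
  · exact dvd_zero _
  have hl : 1 < l := (Fact.out : l.Prime).one_lt
  have hroots : (X ^ l - X : (ZMod l)[X]).roots = Finset.univ.val := by
    have := FiniteField.roots_X_pow_card_sub_X (ZMod l)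
    rwa [ZMod.card] at this
  have hmonic : (X ^ l - X : (ZMod l)[X]).Monic := by
    refine monic_X_pow_sub ?_
    rw [degree_X]
    exact_mod_cast hl
  rw [← prod_multiset_X_sub_C_of_monic_of_roots_card_eq hmonic,
    Multiset.prod_X_sub_C_dvd_iff_le_roots hp, hroots]
  · rw [Multiset.le_iff_subset Finset.univ.nodup]
    intro x _
    rw [mem_roots hp]
    exact h x
  · rw [hroots, FiniteField.X_pow_card_sub_X_natDegree_eq _ hl, Finset.card_val, Finset.card_univ,
      ZMod.card]

theorem not_forall_eval_cubic_pow_eq {l : ℕ} [Fact l.Prime] (hl : 5 < l) {f : (ZMod l)[X]}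
    (hf : f.Monic) (hf3 : f.natDegree = 3) {ε : ZMod l} (hε : ε ≠ 0) :
    ¬ ∀ x, f.eval x ^ (l / 2) = ε := by
  intro h
  have hodd : l % 2 = 1 := (Fact.out : l.Prime).eq_two_or_odd.resolve_left (by omega)
  obtain ⟨g, hg⟩ := X_pow_sub_X_dvd_of_forall_eval_eq_zero
    (show ∀ x, (f ^ (l / 2) - C ε).eval x = 0 by intro x; simp [h x])
  have hQ : (X ^ l - X : (ZMod l)[X]).natDegree = l :=
    FiniteField.X_pow_card_sub_X_natDegree_eq _ (by omega)
  have hfm : (f ^ (l / 2) - C ε).natDegree = 3 * (l / 2) := by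
    rw [natDegree_sub_C, hf.natDegree_pow, hf3, mul_comm]
  have hg0 : g ≠ 0 := by
    rintro rfl
    rw [hg, mul_zero, natDegree_zero] at hfm
    omega
  have hQ0 : (X ^ l - X : (ZMod l)[X]) ≠ 0 := FiniteField.X_pow_card_sub_X_ne_zero _ (by omega)
  have hgdeg : l + g.natDegree = 3 * (l / 2) := by
    rw [← hfm, hg, natDegree_mul hQ0 hg0, hQ]
  have hder := congrArg derivative hg
  have hcast : ((l : ℕ) : (ZMod l)[X]) = 0 := by
    rw [← C_eq_natCast, ZMod.natCast_self, C_0]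
  rw [derivative_sub, derivative_C, derivative_mul, derivative_sub, derivative_X_pow,
    derivative_X, derivative_pow, C_eq_natCast, C_eq_natCast, hcast] at hder
  have hpow : f ^ (l / 2) = f ^ (l / 2 - 1) * f := by
    rw [← pow_succ]; congr 1; omega
  have hmul : C ((l / 2 : ℕ) : ZMod l) * C ε * derivative f + f * g =
      (X ^ l - X) * (f * derivative g - C ((l / 2 : ℕ) : ZMod l) * g * derivative f) := by
    rw [C_eq_natCast]
    linear_combination f * hder - ((l / 2 : ℕ) : (ZMod l)[X]) * derivative f * hg +
      ((l / 2 : ℕ) : (ZMod l)[X]) * derivative f * hpow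
  have hd : (derivative f).natDegree < 3 := by
    rw [← hf3]; exact natDegree_derivative_lt (by omega)
  have hlt : (C ((l / 2 : ℕ) : ZMod l) * C ε * derivative f + f * g).natDegree < l := by
    refine lt_of_le_of_lt (natDegree_add_le _ _) (max_lt ?_ ?_)
    · rw [← C_mul]
      exact lt_of_le_of_lt (natDegree_C_mul_le _ _) (by omega)
    · exact lt_of_le_of_lt natDegree_mul_le (by omega)
  have hzero : C ((l / 2 : ℕ) : ZMod l) * C ε * derivative f + f * g = 0 := by
    by_contra hne
    exact absurd (natDegree_le_of_dvd (Dvd.intro _ hmul.symm) hne) (by omega)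
  have hdvd : f ∣ C ((l / 2 : ℕ) : ZMod l) * C ε * derivative f :=
    ⟨-g, by linear_combination hzero⟩
  have hc : C ((l / 2 : ℕ) : ZMod l) * C ε * derivative f = 0 := by
    by_contra hne
    have h1 := natDegree_le_of_dvd hdvd hne
    rw [← C_mul] at h1
    have h2 := natDegree_C_mul_le (((l / 2 : ℕ) : ZMod l) * ε) (derivative f)
    omega
  have hm0 : ((l / 2 : ℕ) : ZMod l) ≠ 0 := natCast_ne_zero_of_lt (by omega) (by omega)
  have hder0 : derivative f = 0 := by
    rw [← C_mul] at hc
    exact (mul_eq_zero.1 hc).resolve_left (C_ne_zero.2 (mul_ne_zero hm0 hε))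
  have hcoeff := congrArg (fun p => coeff p 2) hder0
  have h3 : f.coeff 3 = 1 := by rw [← hf3]; exact hf
  simp only [coeff_derivative, h3, coeff_zero] at hcoeff
  have := natCast_ne_zero_of_lt (l := l) (n := 3) (by omega) (by omega)
  apply this
  push_cast at hcoeff ⊢
  linear_combination hcoeff

theorem sum_eval_eq_zero_of_coeff_eq_zero {l : ℕ} [Fact l.Prime] {p : (ZMod l)[X]}
    (hp : p.natDegree < 2 * (l - 1)) (h : p.coeff (l - 1) = 0) : ∑ x, p.eval x = 0 := by
  simp_rw [eval_eq_sum_range]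
  rw [Finset.sum_comm]
  refine Finset.sum_eq_zero fun i hi => ?_
  rw [Finset.mem_range] at hi
  rw [← Finset.mul_sum]
  rcases lt_trichotomy i (l - 1) with hlt | rfl | hgt
  · rw [FiniteField.sum_pow_lt_card_sub_one (K := ZMod l) i (by rwa [ZMod.card]), mul_zero]
  · rw [h, zero_mul]
  · have hpow (x : ZMod l) : x ^ i = x ^ (i - (l - 1)) := by
      have h1 : i = l + (i - l) := by omega
      conv_lhs => rw [h1, pow_add, ZMod.pow_card, ← pow_succ']
      congr 1
      omega
    simp_rw [hpow]
    rw [FiniteField.sum_pow_lt_card_sub_one (K := ZMod l) _ (by rw [ZMod.card]; omega), mul_zero]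

theorem sum_quadraticChar_eval_cubic_eq_zero {l : ℕ} [Fact l.Prime] (hl : 5 < l)
    {f : (ZMod l)[X]} (hf : f.Monic) (hf3 : f.natDegree = 3)
    (h : (f ^ (l / 2)).coeff (l - 1) = 0) : ∑ x, quadraticChar (ZMod l) (f.eval x) = 0 := by
  have hchar : ringChar (ZMod l) ≠ 2 := by rw [ZMod.ringChar_zmod_n]; omega
  have hχ (a : ZMod l) : (quadraticChar (ZMod l) a : ZMod l) = a ^ (l / 2) := by
    rw [quadraticChar_eq_pow_of_char_ne_two' hchar, ZMod.card]
  have hdvd : (l : ℤ) ∣ ∑ x, quadraticChar (ZMod l) (f.eval x) := by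
    rw [← ZMod.intCast_zmod_eq_zero_iff_dvd]
    push_cast
    simp_rw [hχ, ← eval_pow]
    refine sum_eval_eq_zero_of_coeff_eq_zero ?_ h
    rw [hf.natDegree_pow, hf3]
    omega
  have hall {e : ℤ} (he : e = 1 ∨ e = -1)
      (h : ∀ x, quadraticChar (ZMod l) (f.eval x) = e) : False := by
    refine not_forall_eval_cubic_pow_eq hl hf hf3 (ε := e) ?_ fun x => ?_
    · rcases he with rfl | rfl <;> simp
    · rw [← hχ, h]
  have hval (a : ZMod l) : quadraticChar (ZMod l) a ≤ 1 ∧ -1 ≤ quadraticChar (ZMod l) a := by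
    rcases eq_or_ne a 0 with rfl | ha
    · simp
    · rcases quadraticChar_dichotomy ha with h | h <;> rw [h] <;> norm_num
  have hub : ∑ x, quadraticChar (ZMod l) (f.eval x) < l := by
    by_contra! hge
    have hsum : ∑ x, (1 - quadraticChar (ZMod l) (f.eval x)) = 0 := by
      refine le_antisymm ?_ (Finset.sum_nonneg fun x _ => by linarith [(hval (f.eval x)).1])
      rw [Finset.sum_sub_distrib, Finset.sum_const, Finset.card_univ, ZMod.card, nsmul_one]
      linarith
    rw [Finset.sum_eq_zero_iff_of_nonneg (fun x _ => by linarith [(hval (f.eval x)).1])] at hsum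
    exact hall (Or.inl rfl) fun x => by linarith [hsum x (Finset.mem_univ x)]
  have hlb : -(l : ℤ) < ∑ x, quadraticChar (ZMod l) (f.eval x) := by
    by_contra! hge
    have hsum : ∑ x, (1 + quadraticChar (ZMod l) (f.eval x)) = 0 := by
      refine le_antisymm ?_ (Finset.sum_nonneg fun x _ => by linarith [(hval (f.eval x)).2])
      rw [Finset.sum_add_distrib, Finset.sum_const, Finset.card_univ, ZMod.card, nsmul_one]
      linarith
    rw [Finset.sum_eq_zero_iff_of_nonneg (fun x _ => by linarith [(hval (f.eval x)).2])] at hsum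
    exact hall (Or.inr rfl) fun x => by linarith [hsum x (Finset.mem_univ x)]
  exact Int.eq_zero_of_abs_lt_dvd hdvd (abs_lt.2 ⟨hlb, hub⟩)

theorem card_point_shortCurve {F : Type*} [Field F] [Fintype F] [DecidableEq F]
    (hF : ringChar F ≠ 2) {A B : F} [(shortCurve A B).IsElliptic]
    (h : ∑ x, quadraticChar F (x ^ 3 + A * x + B) = 0) :
    Nat.card (shortCurve A B).Point = Fintype.card F + 1 := by
  have heq : {xy : F × F // (shortCurve A B).Equation xy.1 xy.2} ≃
      Σ x : F, {y : F // y ^ 2 = x ^ 3 + A * x + B} :=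
    { toFun := fun p => ⟨p.1.1, p.1.2, by
        simpa [shortCurve] using (WeierstrassCurve.Affine.equation_iff p.1.1 p.1.2).1 p.2⟩
      invFun := fun q => ⟨(q.1, q.2.1), by
        rw [WeierstrassCurve.Affine.equation_iff]
        simpa [shortCurve] using q.2.2⟩
      left_inv := fun _ => rfl
      right_inv := fun _ => rfl }
  have hfib (x : F) : (Fintype.card {y : F // y ^ 2 = x ^ 3 + A * x + B} : ℤ) =
      quadraticChar F (x ^ 3 + A * x + B) + 1 := by
    rw [← quadraticChar_card_sqrts hF, Set.toFinset_card]
    rfl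
  have hsig : Fintype.card (Σ x : F, {y : F // y ^ 2 = x ^ 3 + A * x + B}) = Fintype.card F := by
    zify
    rw [Fintype.card_sigma]
    push_cast
    simp_rw [hfib]
    rw [Finset.sum_add_distrib, h]
    simp
  rw [Nat.card_congr (WeierstrassCurve.Affine.pointEquiv (W' := shortCurve A B)), ← hsig,
    ← Nat.card_eq_fintype_card, ← Nat.card_congr heq]
  exact Finite.card_option

theorem isElliptic_shortCurve {F : Type*} [Field F] {c₄ c₆ : F} (h6 : (6 : F) ≠ 0)
    (h : c₄ ^ 3 - c₆ ^ 2 ≠ 0) : (shortCurve (-3 * c₄) (2 * c₆)).IsElliptic := by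
  rw [WeierstrassCurve.isElliptic_iff, isUnit_iff_ne_zero]
  have : (shortCurve (-3 * c₄) (2 * c₆)).Δ = 6 ^ 3 * 8 * (c₄ ^ 3 - c₆ ^ 2) := by
    simp only [shortCurve, WeierstrassCurve.Δ, WeierstrassCurve.b₂, WeierstrassCurve.b₄,
      WeierstrassCurve.b₆, WeierstrassCurve.b₈]
    ring
  have h2 : (8 : F) ≠ 0 := by
    intro h
    apply h6
    have h2 : (2 : F) ^ 3 = 0 := by rw [← h]; norm_num
    have h2' : (2 : F) = 0 := pow_eq_zero_iff (by norm_num) |>.1 h2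
    linear_combination 3 * h2'
  rw [this]
  exact mul_ne_zero (mul_ne_zero (pow_ne_zero 3 h6) h2) h

theorem exists_point_five_nsmul_eq_zero {l : ℕ} [Fact l.Prime] (hl : 5 < l) (hl5 : l % 5 = 4)
    {c₄ c₆ : ZMod l} (hΔ : c₄ ^ 3 - c₆ ^ 2 ≠ 0)
    (h : ((X ^ 3 + C (-3 * c₄) * X + C (2 * c₆)) ^ (l / 2) : (ZMod l)[X]).coeff (l - 1) = 0) :
    ∃ P : (shortCurve (-3 * c₄) (2 * c₆)).Point, P ≠ 0 ∧ 5 • P = 0 := by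
  have h6 : (6 : ZMod l) ≠ 0 := by
    have : l ≠ 6 := by rintro rfl; omega
    exact_mod_cast natCast_ne_zero_of_lt (l := l) (n := 6) (by omega) (by omega)
  have := isElliptic_shortCurve h6 hΔ
  have hchar : ringChar (ZMod l) ≠ 2 := by rw [ZMod.ringChar_zmod_n]; omega
  have hsum := sum_quadraticChar_eval_cubic_eq_zero hl (f := X ^ 3 + C (-3 * c₄) * X + C (2 * c₆))
    (by monicity!) (by compute_degree!) h
  simp only [eval_add, eval_mul, eval_pow, eval_X, eval_C] at hsum
  have hcard := card_point_shortCurve hchar hsum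
  rw [ZMod.card] at hcard
  have : Finite (shortCurve (-3 * c₄) (2 * c₆)).Point := Nat.finite_of_card_ne_zero (by omega)
  have : Fact (Nat.Prime 5) := ⟨by norm_num⟩
  obtain ⟨P, hP⟩ := exists_prime_addOrderOf_dvd_card' (G := (shortCurve (-3 * c₄) (2 * c₆)).Point)
    5 (by rw [hcard]; omega)
  refine ⟨P, ?_, ?_⟩
  · rintro rfl
    simp at hP
  · rw [← hP, addOrderOf_nsmul_eq_zero]

theorem not_isSquare_of_irreducible {F : Type*} [Field F] {a : F} (h2 : (2 : F) ≠ 0)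
    (h : Irreducible (X ^ 2 + C a * X - 1 : F[X])) : ¬ IsSquare (a ^ 2 + 4) := by
  rintro ⟨t, ht⟩
  have hdeg : (X ^ 2 + C a * X - 1 : F[X]).natDegree = 2 := by compute_degree!
  have hroot : (X ^ 2 + C a * X - 1 : F[X]).IsRoot ((t - a) / 2) := by
    simp only [IsRoot, eval_sub, eval_add, eval_mul, eval_pow, eval_X, eval_C, eval_one]
    field_simp
    linear_combination -ht
  have := natDegree_eq_of_degree_eq_some (degree_eq_one_of_irreducible_of_root h hroot)
  rw [hdeg] at this
  norm_num at this

theorem H5_reduction_eq_zero {l : ℕ} [Fact l.Prime] {a : ZMod l} (hd : a ^ 2 + 4 ≠ 0)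
    (h : Irreducible (X ^ 2 + C a * X - 1 : (ZMod l)[X]))
    (hdvd : (X ^ 2 + C a * X - 1 : (ZMod l)[X]) ∣ H5 l) {n r s : ℕ} (hn : n = l / 12)
    (hr : r = if l % 3 = 2 then 1 else 0) (hs : s = if l % 4 = 3 then 1 else 0) :
    (a ^ 2 - 12 * a + 16) ^ r * (a ^ 2 - 18 * a + 76) ^ s *
      ∑ k ∈ Finset.range (n + 1), ((2 * n + s).choose (2 * k + s) : ZMod l) *
        ((2 * n - 2 * k).choose (n - k) : ZMod l) * (-432) ^ (n - k) *
        ((a ^ 2 + 4) * (a ^ 2 - 18 * a + 76) ^ 2) ^ k * (a - 11) ^ (n - k) = 0 := by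
  have : Fact (Irreducible (X ^ 2 + C a * X - 1 : (ZMod l)[X])) := ⟨h⟩
  set p : (ZMod l)[X] := X ^ 2 + C a * X - 1
  set b := AdjoinRoot.root p
  set A := algebraMap (ZMod l) (AdjoinRoot p) a with hA
  have hb : b ^ 2 + A * b - 1 = 0 := by
    have h0 : aeval b (X ^ 2 + C a * X - 1 : (ZMod l)[X]) = 0 := by
      rw [AdjoinRoot.aeval_eq]
      exact AdjoinRoot.mk_self
    rwa [map_sub, map_add, map_mul, map_pow, aeval_X, aeval_C, map_one] at h0
  have hb0 : b ≠ 0 := by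
    intro h0
    rw [h0] at hb
    norm_num at hb
  have hroot : aeval b (H5 l) = 0 := by
    rw [AdjoinRoot.aeval_eq]
    exact AdjoinRoot.mk_eq_zero.2 hdvd
  have hf0 : b ^ 4 + 12 * b ^ 3 + 14 * b ^ 2 - 12 * b + 1 = b ^ 2 * (A ^ 2 - 12 * A + 16) := by
    linear_combination (b ^ 2 + 12 * b - A * b - 1) * hb
  have hf1 : b ^ 4 + 18 * b ^ 3 + 74 * b ^ 2 - 18 * b + 1 = b ^ 2 * (A ^ 2 - 18 * A + 76) := by
    linear_combination (b ^ 2 + 18 * b - A * b - 1) * hb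
  have hsq : (b ^ 2 + 1) ^ 2 = b ^ 2 * (A ^ 2 + 4) := by
    linear_combination (b ^ 2 - A * b - 1) * hb
  have hΔ : b ^ 5 * (1 - 11 * b - b ^ 2) = b ^ 6 * (A - 11) := by
    linear_combination (-b ^ 5) * hb
  have hj : (b ^ 2 * (A ^ 2 - 12 * A + 16)) ^ 3 - 1728 * (b ^ 6 * (A - 11)) =
      b ^ 6 * ((A ^ 2 + 4) * (A ^ 2 - 18 * A + 76) ^ 2) := by
    ring
  have hu : b ^ 2 + 1 ≠ 0 := by
    intro h0
    rw [h0, zero_pow two_ne_zero] at hsq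
    have h1 := (mul_eq_zero.1 hsq.symm).resolve_left (pow_ne_zero 2 hb0)
    apply hd
    apply (algebraMap (ZMod l) (AdjoinRoot p)).injective
    rw [map_add, map_pow, map_ofNat, map_zero, ← hA, h1]
  rw [H5, ← hr, ← hs, ← hn] at hroot
  simp only [map_mul, map_pow, map_add, map_sub, map_sum, map_natCast, map_neg, map_ofNat,
    map_one, aeval_X, hf0, hf1, hΔ, hj] at hroot
  apply (algebraMap (ZMod l) (AdjoinRoot p)).injective
  simp only [map_mul, map_pow, map_add, map_sub, map_sum, map_natCast, map_neg, map_ofNat,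
    map_zero, ← hA]
  have hne : (b ^ 2) ^ r * (b ^ 2 + 1) ^ s * (b ^ 2) ^ s * (b ^ 6) ^ n ≠ 0 := by
    simp [hb0, hu]
  refine (mul_eq_zero.1 ?_).resolve_left hne
  rw [← hroot, Finset.mul_sum, Finset.mul_sum, Finset.mul_sum]
  refine Finset.sum_congr rfl fun k hk => ?_
  rw [Finset.mem_range] at hk
  have hpow : (b ^ 6) ^ n = (b ^ 6) ^ k * (b ^ 6) ^ (n - k) := by
    rw [← pow_add]; congr 1; omega
  rw [hpow]
  simp only [mul_pow]
  ring

/-- If `l > 5` is a prime with `l ≡ 4 (mod 5)`, then no irreducible polynomial of the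
form `x² + ax - 1` over `𝔽_l` divides `Ĥ_{5,l}(x)`. -/
theorem no_quadratic_factor_x2_ax_sub_one (l : ℕ) [Fact l.Prime] (hl : 5 < l)
    (hl5 : l % 5 = 4) :
    ¬ ∃ a : ZMod l, Irreducible (X ^ 2 + C a * X - 1 : Polynomial (ZMod l)) ∧
      (X ^ 2 + C a * X - 1 : Polynomial (ZMod l)) ∣ H5 l := by
  rintro ⟨a, hirr, hdvd⟩
  have hprime : l.Prime := Fact.out
  have hmod2 : l % 2 ≠ 0 := fun h =>
    absurd ((Nat.prime_dvd_prime_iff_eq Nat.prime_two hprime).1 (Nat.dvd_of_mod_eq_zero h))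
      (by omega)
  have hmod3 : l % 3 ≠ 0 := fun h =>
    absurd ((Nat.prime_dvd_prime_iff_eq Nat.prime_three hprime).1 (Nat.dvd_of_mod_eq_zero h))
      (by omega)
  have h2 : (2 : ZMod l) ≠ 0 := by
    exact_mod_cast natCast_ne_zero_of_lt (l := l) (n := 2) (by omega) (by omega)
  have h3 : (3 : ZMod l) ≠ 0 := by
    exact_mod_cast natCast_ne_zero_of_lt (l := l) (n := 3) (by omega) (by omega)
  have h5 : (5 : ZMod l) ≠ 0 := by
    exact_mod_cast natCast_ne_zero_of_lt (l := l) (n := 5) (by omega) (by omega)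
  have h6 : (6 : ZMod l) ≠ 0 := by
    rw [show (6 : ZMod l) = 2 * 3 by norm_num]
    exact mul_ne_zero h2 h3
  have : Fact (Nat.Prime 5) := ⟨by norm_num⟩
  obtain ⟨w, hw⟩ : ∃ w : ZMod l, w ^ 2 = 5 := by
    have hsq : IsSquare ((l : ℕ) : ZMod 5) := by
      refine ⟨2, ?_⟩
      rw [← ZMod.natCast_mod, hl5]
      norm_num
    obtain ⟨w, hw⟩ := (ZMod.exists_sq_eq_prime_iff_of_mod_four_eq_one (p := 5) (q := l)
      (by norm_num) (by omega)).1 hsq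
    exact ⟨w, by rw [sq, ← hw]; norm_num⟩
  have hd := not_isSquare_of_irreducible h2 hirr
  have hd0 : a ^ 2 + 4 ≠ 0 := fun h => hd (by rw [h]; exact IsSquare.zero)
  have ha : a - 11 ≠ 0 := by
    intro h
    refine hd ⟨5 * w, ?_⟩
    rw [eq_add_of_sub_eq h]
    linear_combination -25 * hw
  obtain ⟨n, hn⟩ : ∃ n, n = l / 12 := ⟨_, rfl⟩
  obtain ⟨r, hr⟩ : ∃ r, r = if l % 3 = 2 then 1 else 0 := ⟨_, rfl⟩
  obtain ⟨s, hs⟩ : ∃ s, s = if l % 4 = 3 then 1 else 0 := ⟨_, rfl⟩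
  have hred := H5_reduction_eq_zero hd0 hirr hdvd hn hr hs
  have hcoeff := coeff_cubic_pow_eq_zero (n := n) (r := r) (s := s)
    (by split_ifs at hr <;> omega) (by split_ifs at hs <;> omega)
    (by split_ifs at hr hs <;> omega) hl (c₄ := (a ^ 2 - 12 * a + 16) * (a ^ 2 + 4))
    (c₆ := (a ^ 2 - 18 * a + 76) * (a ^ 2 + 4) ^ 2) (D := -432 * (a ^ 2 + 4) ^ 3 * (a - 11))
    (by ring) (by
      rw [← mul_zero ((a ^ 2 + 4) ^ r * (a ^ 2 + 4) ^ (3 * n + 2 * s)), ← hred, Finset.mul_sum,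
        Finset.mul_sum, Finset.mul_sum]
      refine Finset.sum_congr rfl fun k hk => ?_
      rw [Finset.mem_range] at hk
      obtain ⟨m, rfl⟩ : ∃ m, n = k + m := ⟨n - k, by omega⟩
      rw [Nat.add_sub_cancel_left]
      simp only [mul_pow]
      generalize a ^ 2 + 4 = d, a ^ 2 - 18 * a + 76 = e
      ring)
  obtain ⟨P, hP0, hP⟩ := exists_point_five_nsmul_eq_zero hl hl5 (by
    rw [show ((a ^ 2 - 12 * a + 16) * (a ^ 2 + 4)) ^ 3 -
      ((a ^ 2 - 18 * a + 76) * (a ^ 2 + 4) ^ 2) ^ 2 =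
        6 ^ 3 * 2 ^ 3 * (a ^ 2 + 4) ^ 3 * (a - 11) by ring]
    exact mul_ne_zero (mul_ne_zero (mul_ne_zero (pow_ne_zero 3 h6) (pow_ne_zero 3 h2))
      (pow_ne_zero 3 hd0)) ha) hcoeff
  exact hP0 (eq_zero_of_five_nsmul_eq_zero hw hd h6 h5 hP)
end
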